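/- For every infinite cardinal κ, every rooted tree of size at most κ has a Nash-Williams rank, and this rank is an ordinal strictly less than κ⁺. -/

import Mathlib

universe u v

/-- A topological minor embedding of `H` into `G`: an injective map `toFun` on vertices
together with, for each edge of `H`, a path in `G` joining the images of its endpoints,
such that distinct edges get internally vertex-disjoint paths whose internal vertices
avoid the image of `toFun`. -/
structure TopMinorEmb {V : Type u} {W : Type v} (H : SimpleGraph V) (G : SimpleGraph W) where
  toFun : V → W
  inj : Function.Injective toFun
  path : ∀ ⦃a b : V⦄, H.Adj a b → G.Walk (toFun a) (toFun b)
  path_isPath : ∀ ⦃a b : V⦄ (h : H.Adj a b), (path h).IsPath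
  path_symm : ∀ ⦃a b : V⦄ (h : H.Adj a b), path h.symm = (path h).reverse
  internal_avoid_image : ∀ ⦃a b : V⦄ (h : H.Adj a b) (w : W),
      w ∈ (path h).support → w ≠ toFun a → w ≠ toFun b → ∀ x : V, toFun x ≠ w
  internally_disjoint : ∀ ⦃a b a' b' : V⦄ (h : H.Adj a b) (h' : H.Adj a' b'),
      s(a, b) ≠ s(a', b') → ∀ w : W,
        w ∈ (path h).support → w ∈ (path h').support → w = toFun a ∨ w = toFun b

/-- `H ≤ G`: some subdivision of `H` embeds as a subgraph into `G`. -/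
def TopMinorLE {V : Type u} {W : Type v} (H : SimpleGraph V) (G : SimpleGraph W) : Prop :=
  Nonempty (TopMinorEmb H G)

/-- `G ≡ H`: `G` and `H` have the same topological type. -/
def TopEquiv {V : Type u} {W : Type v} (G : SimpleGraph V) (H : SimpleGraph W) : Prop :=
  TopMinorLE G H ∧ TopMinorLE H G

/-- A rooted graph: a simple graph together with a distinguished root vertex. -/
structure RootedGraph (V : Type u) where
  graph : SimpleGraph V
  root : V

/-- `treeLE G r t s` : the tree-order `t ≤_r s`, i.e. `t` lies on the
(for trees unique) path in `G` from the root `r` to `s`. -/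
def treeLE {V : Type u} (G : SimpleGraph V) (r t s : V) : Prop :=
  ∃ w : G.Walk r s, w.IsPath ∧ t ∈ w.support

/-- `T ≤ S` for rooted graphs: a topological minor embedding of the underlying graphs
that preserves the tree-orders. -/
def RootedLE {V : Type u} {W : Type v} (T : RootedGraph V) (S : RootedGraph W) : Prop :=
  ∃ e : TopMinorEmb T.graph S.graph,
    ∀ x y : V, treeLE T.graph T.root x y → treeLE S.graph S.root (e.toFun x) (e.toFun y)

/-- `T ≡ S` : rooted graphs of the same topological type. -/
def RootedEquiv {V : Type u} {W : Type v} (T : RootedGraph V) (S : RootedGraph W) : Prop :=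
  RootedLE T S ∧ RootedLE S T

/-- The up-closure `{t' : t ≤_r t'}` of `t` (the `insert` is redundant for
connected graphs such as trees). -/
def upSet {V : Type u} (T : RootedGraph V) (t : V) : Set V :=
  insert t {s | treeLE T.graph T.root t s}

/-- The rooted subtree `⌈t⌉`: the subgraph induced on the up-closure of `t`, rooted at `t`. -/
def subtreeAt {V : Type u} (T : RootedGraph V) (t : V) : RootedGraph (upSet T t) :=
  ⟨T.graph.induce (upSet T t), ⟨t, Set.mem_insert t _⟩⟩

/-- Rooted graphs bundled with their vertex type. -/
def RTreeSig := Σ V : Type u, RootedGraph V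

def RTle (T S : RTreeSig.{u}) : Prop := RootedLE T.2 S.2

def RTequiv (T S : RTreeSig.{u}) : Prop := RTle T S ∧ RTle S T

def subtreeSig (T : RTreeSig.{u}) (t : T.1) : RTreeSig.{u} := ⟨upSet T.2 t, subtreeAt T.2 t⟩

/-- `HasNWRankAux α T` : the rooted tree `T` has Nash-Williams rank `α`:
`T` has rank `0` iff `⌈t⌉ ≡ T` for all vertices `t`, and for `α > 0`, `T` has rank `α`
iff it has no rank `< α` and for every vertex `t` either `⌈t⌉ ≡ T` or `⌈t⌉` has some
rank `< α`.  (For `α = 0` the clause below reduces to the former, as no ordinal is `< 0`.) -/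
def HasNWRankAux : Ordinal.{u} → RTreeSig.{u} → Prop :=
  WellFounded.fix Ordinal.lt_wf fun α ih p =>
    (∀ β (hβ : β < α), ¬ ih β hβ p) ∧
    ∀ t : p.1, RTequiv (subtreeSig p t) p ∨ ∃ β, ∃ hβ : β < α, ih β hβ (subtreeSig p t)


/-! ### Arrays indexed by infinite sets of naturals -/

/-- The infinite subsets of `A`. -/
def InfSub (A : Set ℕ) : Set (Set ℕ) := {X | X ⊆ A ∧ X.Infinite}

/-- Remove the least element. -/
def dropMin (X : Set ℕ) : Set ℕ := X \ {sInf X}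

theorem InfSub.mono {A B X : Set ℕ} (h : A ⊆ B) (hX : X ∈ InfSub A) : X ∈ InfSub B :=
  ⟨hX.1.trans h, hX.2⟩

theorem dropMin_subset (X : Set ℕ) : dropMin X ⊆ X := Set.sdiff_subset

theorem dropMin_mem_infSub {A X : Set ℕ} (hX : X ∈ InfSub A) : dropMin X ∈ InfSub A :=
  ⟨(dropMin_subset X).trans hX.1, hX.2.sdiff (Set.finite_singleton _)⟩

theorem sInf_eq_of_agree {X Y : Set ℕ} (hX : X.Nonempty)
    (h : ∀ i ≤ sInf X, (i ∈ Y ↔ i ∈ X)) : sInf Y = sInf X := by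
  have h1 : sInf X ∈ Y := (h _ le_rfl).2 (Nat.sInf_mem hX)
  refine le_antisymm (Nat.sInf_le h1) ?_
  by_contra! hlt
  have := (h _ hlt.le).1 (Nat.sInf_mem ⟨_, h1⟩)
  exact absurd (Nat.sInf_le this) (by omega)

/-- `f` is continuous on the infinite subsets of `A`, for the discrete topology on the
codomain. -/
def LocConst {Q : Type*} (A : Set ℕ) (f : Set ℕ → Q) : Prop :=
  ∀ X ∈ InfSub A, ∃ n, ∀ Y ∈ InfSub A, (∀ i < n, (i ∈ Y ↔ i ∈ X)) → f Y = f X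

namespace LocConst

variable {Q P : Type*} {A B : Set ℕ} {f : Set ℕ → Q} {g : Set ℕ → P}

theorem mono (hf : LocConst A f) (h : B ⊆ A) : LocConst B f := fun X hX => by
  obtain ⟨n, hn⟩ := hf X (InfSub.mono h hX)
  exact ⟨n, fun Y hY => hn Y (InfSub.mono h hY)⟩

theorem comp (hf : LocConst A f) (φ : Q → P) : LocConst A (fun X => φ (f X)) := fun X hX => by
  obtain ⟨n, hn⟩ := hf X hX
  exact ⟨n, fun Y hY h => congrArg φ (hn Y hY h)⟩

theorem prodMk (hf : LocConst A f) (hg : LocConst A g) :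
    LocConst A (fun X => (f X, g X)) := fun X hX => by
  obtain ⟨n, hn⟩ := hf X hX
  obtain ⟨m, hm⟩ := hg X hX
  refine ⟨max n m, fun Y hY h => Prod.ext ?_ ?_⟩
  · exact hn Y hY fun i hi => h i (lt_max_of_lt_left hi)
  · exact hm Y hY fun i hi => h i (lt_max_of_lt_right hi)

theorem comp_dropMin (hf : LocConst A f) : LocConst A (fun X => f (dropMin X)) := fun X hX => by
  obtain ⟨n, hn⟩ := hf _ (dropMin_mem_infSub hX)
  refine ⟨max n (sInf X + 1), fun Y hY h => hn _ (dropMin_mem_infSub hY) fun i hi => ?_⟩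
  have hmin : sInf Y = sInf X := sInf_eq_of_agree hX.2.nonempty fun i hi =>
    h i (lt_max_of_lt_right (Nat.lt_succ_of_le hi))
  simp only [dropMin, hmin, Set.mem_sdiff, h i (lt_max_of_lt_left hi)]

/-- A choice depending on `f X` and `f X⁻` is again continuous. -/
theorem exists_choice (hf : LocConst A f) (p : Q → Q → P → Prop)
    (h : ∀ X ∈ InfSub A, ∃ z, p (f X) (f (dropMin X)) z) [Nonempty P] :
    ∃ g : Set ℕ → P, LocConst A g ∧ ∀ X ∈ InfSub A, p (f X) (f (dropMin X)) (g X) :=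
  ⟨fun X => Classical.epsilon (p (f X) (f (dropMin X))),
    (hf.prodMk hf.comp_dropMin).comp fun q => Classical.epsilon (p q.1 q.2),
    fun X hX => Classical.epsilon_spec (h X hX)⟩

end LocConst

/-! ### Ramsey theorem for clopen sets -/

/-- `P` is homogeneous on the sets which start with `s` and continue in `A` from `m` on, after
shrinking `A`. -/
def RamseyAt (P : Set ℕ → Prop) (A : Set ℕ) (s : Set ℕ) (m : ℕ) : Prop :=
  ∀ A' ∈ InfSub A, ∃ B ∈ InfSub A', ∃ c : Prop, ∀ X ∈ InfSub B, P (s ∪ (X ∩ Set.Ici m)) = c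

theorem ramseyAt_of_forall_insert {P : Set ℕ → Prop} {A s : Set ℕ} {m : ℕ}
    (h : ∀ n ∈ A, m ≤ n → RamseyAt P A (insert n s) (n + 1)) : RamseyAt P A s m := by
  intro A' hA'
  have step : ∀ p : {p : Set ℕ × ℕ // p.1 ∈ InfSub A ∧ p.2 ∈ A ∧ m ≤ p.2},
      ∃ q : {p : Set ℕ × ℕ // p.1 ∈ InfSub A ∧ p.2 ∈ A ∧ m ≤ p.2},
        q.1.1 ⊆ p.1.1 ∧ q.1.2 ∈ p.1.1 ∧ q.1.2 ∈ q.1.1 ∧ p.1.2 < q.1.2 ∧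
        ∃ c : Prop, ∀ X ∈ InfSub q.1.1, P (insert p.1.2 s ∪ (X ∩ Set.Ici (p.1.2 + 1))) = c := by
    rintro ⟨⟨C, a⟩, hC, ha, hm⟩
    obtain ⟨B, hB, c, hc⟩ := h a ha hm C hC
    obtain ⟨b, hb, hab⟩ := hB.2.exists_gt a
    exact ⟨⟨(B, b), InfSub.mono hC.1 hB, hC.1 (hB.1 hb), hm.trans hab.le⟩, hB.1, hB.1 hb, hb, hab, c, hc⟩
  choose next hsub hmem hmem' hlt col hcol using step
  obtain ⟨a₀, ha₀, hma₀⟩ := hA'.2.exists_gt m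
  let p₀ : {p : Set ℕ × ℕ // p.1 ∈ InfSub A ∧ p.2 ∈ A ∧ m ≤ p.2} :=
    ⟨(A', a₀), hA', hA'.1 ha₀, hma₀.le⟩
  let S : ℕ → {p : Set ℕ × ℕ // p.1 ∈ InfSub A ∧ p.2 ∈ A ∧ m ≤ p.2} :=
    fun k => Nat.rec p₀ (fun _ => next) k
  let a : ℕ → ℕ := fun k => (S k).1.2
  let C : ℕ → Set ℕ := fun k => (S k).1.1
  have hamono : StrictMono a := strictMono_nat_of_lt_succ fun k => hlt (S k)
  have hCanti : Antitone C := antitone_nat_of_succ_le fun k => hsub (S k)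
  have haC : ∀ k, a k ∈ C k := by
    intro k
    cases k with
    | zero => exact ha₀
    | succ k => exact hmem' (S k)
  -- infinitely many colours agree
  have : ∃ c : Prop, {k | col (S k) = c}.Infinite := by
    by_contra hcon
    push Not at hcon
    have h1 := (hcon True).union (hcon False)
    refine Set.infinite_univ (h1.subset fun k _ => ?_)
    by_cases hk : col (S k) <;> simp [hk]
  obtain ⟨c, hc⟩ := this
  refine ⟨a '' {k | col (S k) = c}, ⟨?_, hc.image hamono.injective.injOn⟩, c, ?_⟩
  · rintro _ ⟨k, -, rfl⟩
    exact hCanti (Nat.zero_le k) (haC k)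
  intro X hX
  obtain ⟨k, hk, hkX⟩ := hX.1 (Nat.sInf_mem hX.2.nonempty)
  have hX' : dropMin X ∈ InfSub (C (k + 1)) := by
    refine ⟨?_, (dropMin_mem_infSub hX).2⟩
    rintro x ⟨hxX, hx⟩
    obtain ⟨j, -, rfl⟩ := hX.1 hxX
    have h1 : a k < a j := by
      rw [hkX]
      exact lt_of_le_of_ne (Nat.sInf_le hxX) fun h => hx h.symm
    exact hCanti (hamono.lt_iff_lt.1 h1) (haC j)
  rw [← show col (S k) = c from hk, ← hcol (S k) _ hX']
  congr 1
  have hmk : m ≤ a k := (S k).2.2.2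
  ext x
  change _ ↔ x ∈ insert (a k) s ∪ (dropMin X ∩ Set.Ici (a k + 1))
  simp only [Set.mem_union, Set.mem_inter_iff, Set.mem_Ici, Set.mem_insert_iff, dropMin, ← hkX,
    Set.mem_sdiff, Set.mem_singleton_iff]
  have hmin : x ∈ X → a k ≤ x := fun hx => hkX ▸ Nat.sInf_le hx
  have hin : a k ∈ X := hkX ▸ Nat.sInf_mem hX.2.nonempty
  constructor
  · rintro (hx | ⟨hx, -⟩)
    · exact Or.inl (Or.inr hx)
    · by_cases hxa : x = a k
      · exact Or.inl (Or.inl hxa)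
      · exact Or.inr ⟨⟨hx, hxa⟩, by have := hmin hx; omega⟩
  · rintro ((rfl | hx) | ⟨⟨hx, -⟩, -⟩)
    · exact Or.inr ⟨hin, hmk⟩
    · exact Or.inl hx
    · exact Or.inr ⟨hx, hmk.trans (hmin hx)⟩

theorem LocConst.ramsey {A : Set ℕ} (hA : A.Infinite) {P : Set ℕ → Prop} (hP : LocConst A P) :
    ∃ B ∈ InfSub A, (∀ X ∈ InfSub B, P X) ∨ ∀ X ∈ InfSub B, ¬ P X := by
  suffices h0 : RamseyAt P A ∅ 0 by
    obtain ⟨B, hB, c, hc⟩ := h0 A ⟨subset_rfl, hA⟩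
    refine ⟨B, hB, ?_⟩
    have hc' : ∀ X ∈ InfSub B, P X = c := fun X hX => by simpa using hc X hX
    by_cases h : c
    · exact Or.inl fun X hX => (hc' X hX).mpr h
    · exact Or.inr fun X hX hPX => h ((hc' X hX).mp hPX)
  by_contra h0
  have step : ∀ p : {p : Set ℕ × ℕ // ¬ RamseyAt P A p.1 p.2}, ∃ n : ℕ, n ∈ A ∧ p.1.2 ≤ n ∧
      ¬ RamseyAt P A (insert n p.1.1) (n + 1) := by
    rintro ⟨⟨s, m⟩, h⟩
    by_contra! hcon
    exact h (ramseyAt_of_forall_insert fun n hn hm => hcon n hn hm)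
  choose n hnA hnm hnR using step
  let S : ℕ → {p : Set ℕ × ℕ // ¬ RamseyAt P A p.1 p.2} :=
    fun k => Nat.rec ⟨(∅, 0), h0⟩ (fun _ p => ⟨(insert (n p) p.1.1, n p + 1), hnR p⟩) k
  let a : ℕ → ℕ := fun k => n (S k)
  have hamono : StrictMono a := strictMono_nat_of_lt_succ fun k => hnm (S (k + 1))
  have hS1 : ∀ k x, x ∈ (S k).1.1 ↔ ∃ j < k, a j = x := by
    intro k
    induction k with
    | zero => intro x; simp [S]
    | succ k ih =>
      intro x
      change x ∈ insert (a k) (S k).1.1 ↔ _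
      rw [Set.mem_insert_iff, ih]
      constructor
      · rintro (rfl | ⟨j, hj, rfl⟩)
        · exact ⟨k, by omega, rfl⟩
        · exact ⟨j, by omega, rfl⟩
      · rintro ⟨j, hj, rfl⟩
        rcases Nat.lt_succ_iff_lt_or_eq.1 hj with hj | rfl
        · exact Or.inr ⟨j, hj, rfl⟩
        · exact Or.inl rfl
  have hX : Set.range a ∈ InfSub A :=
    ⟨by rintro _ ⟨k, rfl⟩; exact hnA _, Set.infinite_range_of_injective hamono.injective⟩
  obtain ⟨N, hN⟩ := hP _ hX
  have hR := (S (N + 1)).2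
  refine hR fun A' hA' => ⟨A', ⟨subset_rfl, hA'.2⟩, P (Set.range a), fun X hX' => ?_⟩
  have hm : (S (N + 1)).1.2 = a N + 1 := rfl
  have hNa : N ≤ a N := hamono.id_le N
  refine hN _ ⟨?_, ?_⟩ ?_
  · rintro x (hx | hx)
    · obtain ⟨j, -, rfl⟩ := (hS1 (N + 1) x).1 hx
      exact hnA _
    · exact hA'.1 (hX'.1 hx.1)
  · refine Set.Infinite.mono Set.subset_union_right ?_
    intro hfin
    refine hX'.2 ((hfin.union (Set.finite_Iio (S (N + 1)).1.2)).subset fun x hx => ?_)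
    rcases lt_or_ge x (S (N + 1)).1.2 with h | h
    · exact Or.inr h
    · exact Or.inl ⟨hx, h⟩
  · intro i hi
    simp only [Set.mem_union, hS1, Set.mem_inter_iff, Set.mem_Ici, hm, Set.mem_range]
    constructor
    · rintro (⟨j, -, rfl⟩ | ⟨-, h⟩)
      · exact ⟨j, rfl⟩
      · omega
    · rintro ⟨j, rfl⟩
      refine Or.inl ⟨j, ?_, rfl⟩
      have := hamono.id_le j
      simp only [id] at this
      omega

/-! ### Bad arrays and the minimal bad array lemma -/

/-- `f` is a bad array on `A` with respect to `le`. -/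
def BadArray {Q : Type*} (le : Q → Q → Prop) (A : Set ℕ) (f : Set ℕ → Q) : Prop :=
  A.Infinite ∧ LocConst A f ∧ ∀ X ∈ InfSub A, ¬ le (f X) (f (dropMin X))

/-- A bad array together with a modulus of continuity: `f` and `modulus` at `X` depend only on
`X ∩ [0, modulus X]`. -/
structure ModArray {Q : Type*} (le : Q → Q → Prop) where
  dom : Set ℕ
  val : Set ℕ → Q
  modulus : Set ℕ → ℕ
  infinite : dom.Infinite
  modulus_mem : ∀ X ∈ InfSub dom, modulus X ∈ X
  congr : ∀ X ∈ InfSub dom, ∀ Y ∈ InfSub dom, (∀ i ≤ modulus X, (i ∈ Y ↔ i ∈ X)) →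
    val Y = val X ∧ modulus Y = modulus X
  bad : ∀ X ∈ InfSub dom, ¬ le (val X) (val (dropMin X))

theorem LocConst.exists_modulus {Q : Type*} {A : Set ℕ} {f : Set ℕ → Q} (hf : LocConst A f) :
    ∃ τ : Set ℕ → ℕ, (∀ X ∈ InfSub A, τ X ∈ X) ∧
      ∀ X ∈ InfSub A, ∀ Y ∈ InfSub A, (∀ i ≤ τ X, (i ∈ Y ↔ i ∈ X)) → f Y = f X ∧ τ Y = τ X := by
  classical
  let p : Set ℕ → ℕ → Prop := fun X m => m ∈ X ∧
    ∀ Y ∈ InfSub A, (∀ i ≤ m, (i ∈ Y ↔ i ∈ X)) → f Y = f X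
  have hex : ∀ X ∈ InfSub A, ∃ m, p X m := by
    intro X hX
    obtain ⟨n, hn⟩ := hf X hX
    obtain ⟨m, hm, hnm⟩ := hX.2.exists_gt n
    exact ⟨m, hm, fun Y hY h => hn Y hY fun i hi => h i (by omega)⟩
  have hspec : ∀ X ∈ InfSub A, p X (sInf {m | p X m}) := fun X hX => Nat.sInf_mem (hex X hX)
  have key : ∀ X ∈ InfSub A, ∀ Y ∈ InfSub A, (∀ i ≤ sInf {m | p X m}, (i ∈ Y ↔ i ∈ X)) →
      f Y = f X ∧ sInf {m | p Y m} ≤ sInf {m | p X m} := by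
    intro X hX Y hY h
    obtain ⟨h1, h2⟩ := hspec X hX
    have hYX := h2 Y hY h
    refine ⟨hYX, Nat.sInf_le ⟨(h _ le_rfl).2 h1, fun Z hZ hZY => ?_⟩⟩
    rw [hYX]
    exact h2 Z hZ fun i hi => (hZY i hi).trans (h i hi)
  refine ⟨fun X => sInf {m | p X m}, fun X hX => (hspec X hX).1, fun X hX Y hY h => ?_⟩
  obtain ⟨h1, h2⟩ := key X hX Y hY h
  exact ⟨h1, le_antisymm h2 (key Y hY X hX fun i hi => (h i (hi.trans h2)).symm).2⟩

theorem BadArray.exists_modArray {Q : Type*} {le : Q → Q → Prop} {A : Set ℕ} {f : Set ℕ → Q}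
    (hf : BadArray le A f) : ∃ c : ModArray le, c.dom = A ∧ c.val = f := by
  obtain ⟨τ, h1, h2⟩ := hf.2.1.exists_modulus
  exact ⟨⟨A, f, τ, hf.1, h1, h2, hf.2.2⟩, rfl, rfl⟩

namespace ModArray

variable {Q : Type*} {le : Q → Q → Prop} {R : Q → Q → Prop}

theorem badArray (c : ModArray le) : BadArray le c.dom c.val :=
  ⟨c.infinite, fun X hX => ⟨c.modulus X + 1, fun Y hY h =>
    (c.congr X hX Y hY fun i hi => h i (by omega)).1⟩, c.bad⟩

/-- `c'` lives on a smaller set, and each of its values is either unchanged, modulus included, or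
has decreased. -/
def Refines (R : Q → Q → Prop) (c' c : ModArray le) : Prop :=
  c'.dom ⊆ c.dom ∧ ∀ X ∈ InfSub c'.dom, (c'.val X = c.val X ∧ c'.modulus X = c.modulus X) ∨
    (R (c'.val X) (c.val X) ∧ c.modulus X ≤ c'.modulus X)

theorem Refines.refl (c : ModArray le) : Refines R c c :=
  ⟨subset_rfl, fun _ _ => Or.inl ⟨rfl, rfl⟩⟩

theorem Refines.trans [IsTrans Q R] {a b c : ModArray le} (h : Refines R a b)
    (h' : Refines R b c) : Refines R a c := by
  refine ⟨h.1.trans h'.1, fun X hX => ?_⟩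
  rcases h.2 X hX with ⟨h1, h2⟩ | ⟨h1, h2⟩ <;>
    rcases h'.2 X (InfSub.mono h.1 hX) with ⟨h3, h4⟩ | ⟨h3, h4⟩
  · exact Or.inl ⟨h1.trans h3, h2.trans h4⟩
  · exact Or.inr ⟨h1 ▸ h3, h2 ▸ h4⟩
  · exact Or.inr ⟨h3 ▸ h1, h4 ▸ h2⟩
  · exact Or.inr ⟨_root_.trans h1 h3, h4.trans h2⟩

theorem Refines.modulus_le {a b : ModArray le} (h : Refines R a b) {X : Set ℕ}
    (hX : X ∈ InfSub a.dom) : b.modulus X ≤ a.modulus X := by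
  rcases h.2 X hX with h | h
  · exact h.2.ge
  · exact h.2

/-- `c'.dom` and `c.dom` have the same elements up to `a`. -/
def Keeps (a : ℕ) (c' c : ModArray le) : Prop := ∀ i ≤ a, (i ∈ c'.dom ↔ i ∈ c.dom)

open Classical in
/-- `0` if `c` is not yet decided by the initial segment `s` of `[0, a]`, and a successor of the
rank of the decided value otherwise. -/
noncomputable def status (R : Q → Q → Prop) [IsWellFounded Q R] (c : ModArray le) (a : ℕ)
    (s : Finset ℕ) : Ordinal :=
  if h : ∃ X ∈ InfSub c.dom, (∀ i ≤ a, (i ∈ X ↔ i ∈ s)) ∧ c.modulus X ≤ a then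
    Order.succ (IsWellFounded.rank R (c.val h.choose)) else 0

variable [IsWellFounded Q R]

theorem status_eq (c : ModArray le) {a : ℕ} {s : Finset ℕ} {X : Set ℕ} (hX : X ∈ InfSub c.dom)
    (hs : ∀ i ≤ a, (i ∈ X ↔ i ∈ s)) (ha : c.modulus X ≤ a) :
    status R c a s = Order.succ (IsWellFounded.rank R (c.val X)) := by
  have h : ∃ X ∈ InfSub c.dom, (∀ i ≤ a, (i ∈ X ↔ i ∈ s)) ∧ c.modulus X ≤ a := ⟨X, hX, hs, ha⟩
  rw [status, dif_pos h]
  obtain ⟨h1, h2, -⟩ := h.choose_spec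
  rw [(c.congr X hX _ h1 fun i hi => (h2 i (hi.trans ha)).trans (hs i (hi.trans ha)).symm).1]

theorem Refines.status_le {c' c : ModArray le} (h : Refines R c' c) (a : ℕ) (s : Finset ℕ) :
    status R c' a s ≤ status R c a s := by
  by_cases hex : ∃ X ∈ InfSub c'.dom, (∀ i ≤ a, (i ∈ X ↔ i ∈ s)) ∧ c'.modulus X ≤ a
  · obtain ⟨X, hX, hs, ha⟩ := hex
    rw [status_eq c' hX hs ha,
      status_eq c (InfSub.mono h.1 hX) hs ((h.modulus_le hX).trans ha)]
    rcases h.2 X hX with h | h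
    · rw [h.1]
    · exact Order.succ_le_succ (IsWellFounded.rank_lt_of_rel h.1).le
  · rw [status, dif_neg hex]
    exact zero_le

/-- All the statuses at `a`. -/
noncomputable def statuses (R : Q → Q → Prop) [IsWellFounded Q R] (c : ModArray le) (a : ℕ) :
    (Finset.range (a + 1)).powerset → Ordinal := fun s => status R c a s

theorem exists_minimal_keeps [IsTrans Q R] (c : ModArray le) (a : ℕ) :
    ∃ c' : ModArray le, Refines R c' c ∧ Keeps a c' c ∧
      ∀ d : ModArray le, Refines R d c' → Keeps a d c' → ¬ statuses R d a < statuses R c' a := by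
  have hwf : WellFounded fun d d' : ModArray le => statuses R d a < statuses R d' a :=
    InvImage.wf (fun d => statuses R d a) wellFounded_lt
  obtain ⟨c', ⟨h1, h2⟩, hmin⟩ := hwf.has_min {d | Refines R d c ∧ Keeps a d c}
    ⟨c, Refines.refl c, fun _ _ => Iff.rfl⟩
  exact ⟨c', h1, h2, fun d hd hk =>
    hmin d ⟨hd.trans h1, fun i hi => (hk i hi).trans (h2 i hi)⟩⟩

/-- Amalgamation of `c` with a strictly smaller array `d`, keeping an initial part of `c.dom`. -/
theorem exists_amalgam [IsTrans Q R] (hle : ∀ x y z, le x y → R y z → le x z) (c : ModArray le)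
    {B : Set ℕ} {h : Set ℕ → Q} (hB : B ⊆ c.dom) (hh : BadArray le B h)
    (hlt : ∀ X ∈ InfSub B, R (h X) (c.val X)) :
    ∃ n ∈ c.dom, ∃ d : ModArray le, Refines R d c ∧ Keeps n d c ∧
      statuses R d n < statuses R c n := by
  classical
  -- choose `X ⊆ B` with least modulus
  obtain ⟨n, ⟨X, hX, rfl⟩, hmin⟩ : ∃ n, n ∈ c.modulus '' InfSub B ∧
      ∀ m ∈ c.modulus '' InfSub B, n ≤ m :=
    ⟨_, Nat.sInf_mem ⟨_, B, ⟨subset_rfl, hh.1⟩, rfl⟩, fun m hm => Nat.sInf_le hm⟩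
  set n := c.modulus X
  obtain ⟨σ, hσ1, hσ2⟩ := hh.2.1.exists_modulus
  let A' : Set ℕ := {i | (i ∈ c.dom ∧ i ≤ n) ∨ i ∈ B}
  have hA' : A' ⊆ c.dom := by
    rintro i (⟨h, -⟩ | h)
    exacts [h, hB h]
  have hBA' : B ⊆ A' := fun i hi => Or.inr hi
  have hnA : n ∈ c.dom := hB (hX.1 (c.modulus_mem X (InfSub.mono hB hX)))
  -- a set whose decided part lies in `B` lies entirely in `B`
  have hsub : ∀ Y ∈ InfSub A', (∀ i ≤ c.modulus Y, i ∈ Y → i ∈ B) → Y ⊆ B := by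
    intro Y hY hYB
    let X' : Set ℕ := {i | (i ≤ c.modulus Y ∧ i ∈ Y) ∨ (c.modulus Y < i ∧ i ∈ B)}
    have hX' : X' ∈ InfSub B := by
      constructor
      · rintro i (⟨h1, h2⟩ | ⟨-, h⟩)
        exacts [hYB i h1 h2, h]
      · intro hfin
        refine hh.1 ((hfin.union (Set.finite_Iic (c.modulus Y))).subset fun i hi => ?_)
        rcases le_or_gt i (c.modulus Y) with h | h
        · exact Or.inr h
        · exact Or.inl (Or.inr ⟨h, hi⟩)
    have hmod := (c.congr Y (InfSub.mono hA' hY) X' (InfSub.mono hB hX') fun i hi => by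
      simp only [X', Set.mem_ofPred_eq, hi, true_and]
      constructor
      · rintro (h | ⟨h, -⟩)
        · exact h
        · omega
      · exact Or.inl).2
    have hn : n ≤ c.modulus Y := hmod ▸ hmin _ ⟨X', hX', rfl⟩
    intro i hi
    rcases hY.1 hi with ⟨-, h⟩ | h
    · exact hYB i (h.trans hn) hi
    · exact h
  let val : Set ℕ → Q := fun Y => if Y ⊆ B then h Y else c.val Y
  let md : Set ℕ → ℕ := fun Y => if Y ⊆ B then max (σ Y) (c.modulus Y) else c.modulus Y
  have hval : ∀ Y, Y ⊆ B → val Y = h Y := fun Y hY => if_pos hY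
  have hval' : ∀ Y, ¬ Y ⊆ B → val Y = c.val Y := fun Y hY => if_neg hY
  have hmd : ∀ Y, Y ⊆ B → md Y = max (σ Y) (c.modulus Y) := fun Y hY => if_pos hY
  have hmd' : ∀ Y, ¬ Y ⊆ B → md Y = c.modulus Y := fun Y hY => if_neg hY
  have hsub' : ∀ Y ∈ InfSub A', ∀ Z ∈ InfSub A', (∀ i ≤ c.modulus Y, (i ∈ Z ↔ i ∈ Y)) →
      (Z ⊆ B ↔ Y ⊆ B) := by
    intro Y hY Z hZ hag
    have hmod := (c.congr Y (InfSub.mono hA' hY) Z (InfSub.mono hA' hZ) hag).2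
    constructor
    · exact fun hZB => hsub Y hY fun i hi hiY => hZB ((hag i hi).2 hiY)
    · exact fun hYB => hsub Z hZ fun i hi hiZ => hYB ((hag i (hmod ▸ hi)).1 hiZ)
  have hστ : ∀ Y ∈ InfSub A', c.modulus Y ≤ md Y := by
    intro Y hY
    by_cases hYB : Y ⊆ B
    · rw [hmd Y hYB]; exact le_max_right _ _
    · rw [hmd' Y hYB]
  let d : ModArray le :=
    { dom := A'
      val := val
      modulus := md
      infinite := hh.1.mono hBA'
      modulus_mem := by
        intro Y hY
        by_cases hYB : Y ⊆ B
        · rw [hmd Y hYB]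
          rcases max_choice (σ Y) (c.modulus Y) with h | h <;> rw [h]
          · exact hσ1 Y ⟨hYB, hY.2⟩
          · exact c.modulus_mem Y (InfSub.mono hA' hY)
        · rw [hmd' Y hYB]
          exact c.modulus_mem Y (InfSub.mono hA' hY)
      congr := by
        intro Y hY Z hZ hag
        have hag' : ∀ i ≤ c.modulus Y, (i ∈ Z ↔ i ∈ Y) := fun i hi => hag i (hi.trans (hστ Y hY))
        have hiff := hsub' Y hY Z hZ hag'
        have hc := c.congr Y (InfSub.mono hA' hY) Z (InfSub.mono hA' hZ) hag'
        by_cases hYB : Y ⊆ B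
        · have hZB := hiff.2 hYB
          rw [hmd Y hYB] at hag
          have := hσ2 Y ⟨hYB, hY.2⟩ Z ⟨hZB, hZ.2⟩ fun i hi => hag i (le_max_of_le_left hi)
          rw [hval Y hYB, hval Z hZB, hmd Y hYB, hmd Z hZB, hc.2, this.2]
          exact ⟨this.1, rfl⟩
        · have hZB := mt hiff.1 hYB
          rw [hval' Y hYB, hval' Z hZB, hmd' Y hYB, hmd' Z hZB]
          exact hc
      bad := by
        intro Y hY
        by_cases hYB : Y ⊆ B
        · rw [hval Y hYB, hval _ ((dropMin_subset Y).trans hYB)]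
          exact hh.2.2 Y ⟨hYB, hY.2⟩
        · rw [hval' Y hYB]
          by_cases hYB' : dropMin Y ⊆ B
          · rw [hval _ hYB']
            exact fun hcon => c.bad Y (InfSub.mono hA' hY)
              (hle _ _ _ hcon (hlt _ ⟨hYB', (dropMin_mem_infSub hY).2⟩))
          · rw [hval' _ hYB']
            exact c.bad Y (InfSub.mono hA' hY) }
  have hd : Refines R d c := by
    refine ⟨hA', fun Y hY => ?_⟩
    by_cases hYB : Y ⊆ B
    · refine Or.inr ⟨?_, hστ Y hY⟩
      change R (val Y) _
      rw [hval Y hYB]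
      exact hlt Y ⟨hYB, hY.2⟩
    · exact Or.inl ⟨hval' Y hYB, hmd' Y hYB⟩
  refine ⟨n, hnA, d, hd, fun i hi => ⟨fun h => hA' h, fun h => Or.inl ⟨h, hi⟩⟩, ?_⟩
  refine Pi.lt_def.2 ⟨fun s => hd.status_le n s, ?_⟩
  have hXA := InfSub.mono hB hX
  let s : Finset ℕ := (Finset.range (n + 1)).filter (· ∈ X)
  have hs : ∀ i ≤ n, (i ∈ X ↔ i ∈ s) := fun i hi => by
    simp only [s, Finset.mem_filter, Finset.mem_range]
    constructor
    · exact fun h => ⟨by omega, h⟩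
    · exact fun h => h.2
  refine ⟨⟨s, Finset.mem_powerset.2 (Finset.filter_subset _ _)⟩, ?_⟩
  change status R d n s < status R c n s
  rw [status_eq c hXA hs le_rfl]
  by_cases hex : ∃ Z ∈ InfSub d.dom, (∀ i ≤ n, (i ∈ Z ↔ i ∈ s)) ∧ d.modulus Z ≤ n
  · obtain ⟨Z, hZ, hZs, hZn⟩ := hex
    rw [status_eq d hZ hZs hZn]
    have hag : ∀ i ≤ c.modulus X, (i ∈ Z ↔ i ∈ X) := fun i hi =>
      (hZs i hi).trans (hs i hi).symm
    have hZB : Z ⊆ B := (hsub' X (InfSub.mono hBA' hX) Z hZ hag).2 hX.1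
    have hv : d.val Z = h Z := hval Z hZB
    rw [hv, ← (c.congr X hXA Z (InfSub.mono hA' hZ) hag).1]
    exact Order.succ_lt_succ (IsWellFounded.rank_lt_of_rel (hlt Z ⟨hZB, hZ.2⟩))
  · rw [status, dif_neg hex]
    exact Order.bot_lt_succ _

/-- The limit of a refining sequence with stabilizing domains. -/
theorem exists_limit [IsTrans Q R] (S : ℕ → ModArray le) (a : ℕ → ℕ) (ha : StrictMono a)
    (haS : ∀ k, a k ∈ (S k).dom) (hS : ∀ k, Refines R (S (k + 1)) (S k))
    (hK : ∀ k, Keeps (a k) (S (k + 1)) (S k)) :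
    ∃ c : ModArray le, c.dom = {i | ∀ k, i ∈ (S k).dom} ∧
      ∀ k, Refines R c (S k) ∧ Keeps (a k) c (S k) := by
  have hR : ∀ k j, k ≤ j → Refines R (S j) (S k) := by
    intro k j hkj
    induction hkj with
    | refl => exact Refines.refl _
    | step _ ih => exact (hS _).trans ih
  have hKj : ∀ k j, k ≤ j → Keeps (a k) (S j) (S k) := by
    intro k j hkj
    induction hkj with
    | refl => exact fun _ _ => Iff.rfl
    | step hj ih => exact fun i hi => (hK _ i (hi.trans (ha.monotone hj))).trans (ih i hi)
  let A : Set ℕ := {i | ∀ k, i ∈ (S k).dom}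
  have hAS : ∀ k, A ⊆ (S k).dom := fun k i hi => hi k
  have hAK : ∀ k, ∀ i ≤ a k, (i ∈ A ↔ i ∈ (S k).dom) := by
    refine fun k i hi => ⟨fun h => h k, fun h j => ?_⟩
    rcases le_total k j with hkj | hjk
    · exact (hKj k j hkj i hi).2 h
    · exact (hR j k hjk).1 h
  have haA : ∀ k, a k ∈ A := fun k => (hAK k _ le_rfl).2 (haS k)
  -- pointwise stabilization
  have hstab : ∀ X ∈ InfSub A, ∃ N, ∀ k ≥ N, (S k).val X = (S N).val X ∧
      (S k).modulus X = (S N).modulus X := by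
    intro X hX
    obtain ⟨_, ⟨N, rfl⟩, hN⟩ := (IsWellFounded.wf (r := R)).has_min
      (Set.range fun k => (S k).val X) ⟨_, 0, rfl⟩
    refine ⟨N, fun k hk => ?_⟩
    rcases (hR N k hk).2 X (InfSub.mono (hAS k) hX) with h | h
    · exact h
    · exact absurd h.1 (hN _ ⟨k, rfl⟩)
  choose! N hN using hstab
  let val : Set ℕ → Q := fun X => (S (N X)).val X
  let md : Set ℕ → ℕ := fun X => (S (N X)).modulus X
  have hlim : ∀ X ∈ InfSub A, ∀ M, (∀ k ≥ M, (S k).val X = (S M).val X ∧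
      (S k).modulus X = (S M).modulus X) → val X = (S M).val X ∧ md X = (S M).modulus X := by
    intro X hX M hM
    have h1 := hN X hX (max (N X) M) (le_max_left _ _)
    have h2 := hM (max (N X) M) (le_max_right _ _)
    exact ⟨h1.1.symm.trans h2.1, h1.2.symm.trans h2.2⟩
  let c : ModArray le :=
    { dom := A
      val := val
      modulus := md
      infinite := (Set.infinite_range_of_injective ha.injective).mono
        (by rintro _ ⟨k, rfl⟩; exact haA k)
      modulus_mem := fun X hX => (S (N X)).modulus_mem X (InfSub.mono (hAS _) hX)
      congr := by
        intro X hX Y hY hag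
        have hc : ∀ k ≥ N X, (S k).val Y = val X ∧ (S k).modulus Y = md X := by
          intro k hk
          have h1 := hN X hX k hk
          have h2 := (S k).congr X (InfSub.mono (hAS k) hX) Y (InfSub.mono (hAS k) hY)
            fun i hi => hag i (hi.trans h1.2.le)
          exact ⟨h2.1.trans h1.1, h2.2.trans h1.2⟩
        have h0 := hc (N X) le_rfl
        have h1 := hlim Y hY (N X) fun k hk =>
          ⟨(hc k hk).1.trans h0.1.symm, (hc k hk).2.trans h0.2.symm⟩
        exact ⟨h1.1.trans h0.1, h1.2.trans h0.2⟩
      bad := by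
        intro X hX
        have hX' := dropMin_mem_infSub hX
        let k := max (N X) (N (dropMin X))
        have h1 := hN X hX k (le_max_left _ _)
        have h2 := hN _ hX' k (le_max_right _ _)
        change ¬ le ((S (N X)).val X) ((S (N (dropMin X))).val (dropMin X))
        rw [← h1.1, ← h2.1]
        exact (S k).bad X (InfSub.mono (hAS k) hX) }
  refine ⟨c, rfl, fun k => ⟨⟨hAS k, fun X hX => ?_⟩, hAK k⟩⟩
  have hj := hN X hX (max k (N X)) (le_max_right _ _)
  have := (hR k (max k (N X)) (le_max_left _ _)).2 X (InfSub.mono (hAS _) hX)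
  rwa [hj.1, hj.2] at this

end ModArray

/-- The minimal bad array lemma. -/
theorem BadArray.exists_minimal {Q : Type*} {le R : Q → Q → Prop} [IsWellFounded Q R] [IsTrans Q R]
    (hle : ∀ x y z, le x y → R y z → le x z) {A : Set ℕ} {f : Set ℕ → Q} (hf : BadArray le A f) :
    ∃ B ⊆ A, ∃ g : Set ℕ → Q, BadArray le B g ∧
      (∀ X ∈ InfSub B, g X = f X ∨ R (g X) (f X)) ∧
      ∀ C ⊆ B, ∀ h : Set ℕ → Q, BadArray le C h → ¬ ∀ X ∈ InfSub C, R (h X) (g X) := by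
  obtain ⟨c₀, rfl, rfl⟩ := hf.exists_modArray
  have step : ∀ p : {p : ModArray le × ℕ // p.2 ∈ p.1.dom},
      ∃ q : {p : ModArray le × ℕ // p.2 ∈ p.1.dom},
        ModArray.Refines R q.1.1 p.1.1 ∧ ModArray.Keeps p.1.2 q.1.1 p.1.1 ∧
        (∀ d : ModArray le, ModArray.Refines R d q.1.1 → ModArray.Keeps p.1.2 d q.1.1 →
          ¬ ModArray.statuses R d p.1.2 < ModArray.statuses R q.1.1 p.1.2) ∧
        p.1.2 < q.1.2 ∧ ∀ i ∈ q.1.1.dom, p.1.2 < i → q.1.2 ≤ i := by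
    rintro ⟨⟨c, a⟩, ha⟩
    obtain ⟨c', h1, h2, h3⟩ := ModArray.exists_minimal_keeps (R := R) c a
    have hne : {i | i ∈ c'.dom ∧ a < i}.Nonempty := by
      obtain ⟨b, hb, hab⟩ := c'.infinite.exists_gt a
      exact ⟨b, hb, hab⟩
    exact ⟨⟨(c', sInf {i | i ∈ c'.dom ∧ a < i}), (Nat.sInf_mem hne).1⟩, h1, h2, h3,
      (Nat.sInf_mem hne).2, fun i hi hai => Nat.sInf_le ⟨hi, hai⟩⟩
  choose next hR hK hmin hlt hnext using step
  let p₀ : {p : ModArray le × ℕ // p.2 ∈ p.1.dom} :=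
    ⟨(c₀, sInf c₀.dom), Nat.sInf_mem c₀.infinite.nonempty⟩
  let S : ℕ → {p : ModArray le × ℕ // p.2 ∈ p.1.dom} := fun k => Nat.rec p₀ (fun _ => next) k
  have ha : StrictMono fun k => (S k).1.2 := strictMono_nat_of_lt_succ fun k => hlt (S k)
  obtain ⟨c, hdom, hc⟩ := ModArray.exists_limit (R := R) (fun k => (S k).1.1) (fun k => (S k).1.2)
    ha (fun k => (S k).2) (fun k => hR (S k)) (fun k => hK (S k))
  refine ⟨c.dom, (hc 0).1.1, c.val, c.badArray, fun X hX => ?_, fun C hC h hh hcon => ?_⟩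
  · exact ((hc 0).1.2 X hX).imp And.left And.left
  obtain ⟨n, hn, d, hd, hdK, hdlt⟩ := c.exists_amalgam hle hC hh hcon
  -- every element of the limit domain is one of the chosen points
  obtain ⟨k, rfl⟩ : ∃ k, (S k).1.2 = n := by
    have hex : ∃ k, n ≤ (S k).1.2 := ⟨n, ha.id_le n⟩
    rw [hdom] at hn
    classical
    refine ⟨Nat.find hex, le_antisymm ?_ (Nat.find_spec hex)⟩
    rcases hk : Nat.find hex with _ | k
    · exact Nat.sInf_le (hn 0)
    · have : (S k).1.2 < n := not_le.1 (Nat.find_min hex (by omega))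
      exact hnext (S k) n (hn (k + 1)) this
  have hle' := hc (k + 1)
  have hKk : ModArray.Keeps (S k).1.2 c (S (k + 1)).1.1 := fun i hi =>
    hle'.2 i (hi.trans (ha (Nat.lt_succ_self k)).le)
  refine hmin (S k) d (hd.trans hle'.1) (fun i hi => (hdK i hi).trans (hKk i hi))
    (lt_of_lt_of_le hdlt fun s => hle'.1.status_le _ s)

/-! ### Transfinite sequences -/

/-- `s` embeds into `t` as a sequence, where `s` stands for the restriction of `s.2` to the ordinals
less than `s.1`. -/
def SeqLE {Q : Type*} (le : Q → Q → Prop) (s t : Ordinal.{u} × (Ordinal.{u} → Q)) : Prop :=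
  ∃ φ : Ordinal.{u} → Ordinal.{u}, (∀ i j, i < j → j < s.1 → φ i < φ j) ∧
    ∀ i < s.1, φ i < t.1 ∧ le (s.2 i) (t.2 (φ i))

/-- `s` is a proper initial segment of `t`. -/
def SeqLT {Q : Type*} (s t : Ordinal.{u} × (Ordinal.{u} → Q)) : Prop := s.1 < t.1 ∧ s.2 = t.2

instance {Q : Type*} : IsTrans (Ordinal.{u} × (Ordinal.{u} → Q)) SeqLT :=
  ⟨fun _ _ _ h h' => ⟨h.1.trans h'.1, h.2.trans h'.2⟩⟩

instance {Q : Type*} : IsWellFounded (Ordinal.{u} × (Ordinal.{u} → Q)) SeqLT :=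
  ⟨Subrelation.wf (fun h => h.1) (InvImage.wf Prod.fst Ordinal.lt_wf)⟩

section SeqLE

variable {Q : Type*} {le : Q → Q → Prop}

theorem SeqLE.of_seqLE_of_seqLT (s t w : Ordinal.{u} × (Ordinal.{u} → Q)) (h : SeqLE le s t)
    (h' : SeqLT t w) : SeqLE le s w := by
  obtain ⟨φ, h1, h2⟩ := h
  exact ⟨φ, h1, fun i hi => ⟨(h2 i hi).1.trans h'.1, h'.2 ▸ (h2 i hi).2⟩⟩

open Classical in
theorem SeqLE.succ {s t : Ordinal.{u} × (Ordinal.{u} → Q)} (h : SeqLE le s t)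
    (h' : le (s.2 s.1) (t.2 t.1)) :
    SeqLE le (Order.succ s.1, s.2) (Order.succ t.1, t.2) := by
  obtain ⟨φ, h1, h2⟩ := h
  refine ⟨fun i => if i < s.1 then φ i else t.1, fun i j hij hj => ?_, fun i hi => ?_⟩
  · have hj' : j ≤ s.1 := Order.lt_succ_iff.1 hj
    dsimp only
    rw [if_pos (hij.trans_le hj')]
    split_ifs with h
    · exact h1 i j hij h
    · exact (h2 i (hij.trans_le hj')).1
  · dsimp only
    rcases (Order.lt_succ_iff.1 hi).lt_or_eq with h | rfl
    · rw [if_pos h]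
      exact ⟨(h2 i h).1.trans (Order.lt_succ _), (h2 i h).2⟩
    · rw [if_neg (lt_irrefl _)]
      exact ⟨Order.lt_succ _, h'⟩

/-- The greedy embedding of `x` into `y`. -/
noncomputable def greedy (le : Q → Q → Prop) (x y : Ordinal.{u} → Q) : Ordinal.{u} → Ordinal.{u} :=
  WellFounded.fix Ordinal.lt_wf fun i φ =>
    sInf {j | (∀ i', ∀ h : i' < i, φ i' h < j) ∧ le (x i) (y j)}

theorem greedy_eq (x y : Ordinal.{u} → Q) (i : Ordinal.{u}) : greedy le x y i =
    sInf {j | (∀ i' < i, greedy le x y i' < j) ∧ le (x i) (y j)} := by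
  rw [greedy, WellFounded.fix_eq]

theorem SeqLE.of_forall_lt {α : Ordinal.{u}} {x : Ordinal.{u} → Q}
    {t : Ordinal.{u} × (Ordinal.{u} → Q)}
    (h : ∀ δ < α, SeqLE le (Order.succ δ, x) t) : SeqLE le (α, x) t := by
  have key : ∀ i < α, (∀ i' < i, greedy le x t.2 i' < greedy le x t.2 i) ∧
      greedy le x t.2 i < t.1 ∧ le (x i) (t.2 (greedy le x t.2 i)) := by
    intro i hi
    obtain ⟨ψ, h1, h2⟩ := h i hi
    have hle : ∀ k ≤ i, ψ k ∈ {j | (∀ i' < k, greedy le x t.2 i' < j) ∧ le (x k) (t.2 j)} := by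
      intro k
      induction k using WellFoundedLT.induction with
      | ind k ih =>
        intro hk
        refine ⟨fun i' hi' => lt_of_le_of_lt ?_ (h1 i' k hi' (Order.lt_succ_iff.2 hk)),
          (h2 k (Order.lt_succ_iff.2 hk)).2⟩
        rw [greedy_eq]
        exact csInf_le' (ih i' hi' (hi'.le.trans hk))
    have hmem := csInf_mem ⟨_, hle i le_rfl⟩
    rw [← greedy_eq] at hmem
    refine ⟨hmem.1, lt_of_le_of_lt ?_ (h2 i (Order.lt_succ i)).1, hmem.2⟩
    rw [greedy_eq]
    exact csInf_le' (hle i le_rfl)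
  exact ⟨greedy le x t.2, fun i j hij hj => (key j hj).1 i hij, fun i hi => (key i hi).2⟩

theorem exists_seqLE_not_seqLE_succ {s t : Ordinal.{u} × (Ordinal.{u} → Q)} (h : ¬ SeqLE le s t) :
    ∃ δ, δ < s.1 ∧ SeqLE le (δ, s.2) t ∧ ¬ SeqLE le (Order.succ δ, s.2) t := by
  by_contra! hcon
  refine h ?_
  have : ∀ γ ≤ s.1, SeqLE le (γ, s.2) t := by
    intro γ
    induction γ using WellFoundedLT.induction with
    | ind γ ih =>
      exact fun hγ => SeqLE.of_forall_lt fun δ hδ =>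
        hcon δ (hδ.trans_le hγ) (ih δ hδ (hδ.le.trans hγ))
  exact this _ le_rfl

/-- A bad array of transfinite sequences yields a bad array of entries. -/
theorem BadArray.exists_entry {A : Set ℕ} {f : Set ℕ → Ordinal.{u} × (Ordinal.{u} → Q)}
    (hf : BadArray (SeqLE le) A f) : ∃ C ⊆ A, ∃ q : Set ℕ → Q, BadArray le C q ∧
      ∀ X ∈ InfSub C, ∃ i < (f X).1, q X = (f X).2 i := by
  obtain ⟨B, hB, g, hg, hgf, hmin⟩ := hf.exists_minimal (R := SeqLT) SeqLE.of_seqLE_of_seqLT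
  obtain ⟨δ, hδ, hδp⟩ := hg.2.1.exists_choice
    (fun s t δ => δ < s.1 ∧ SeqLE le (δ, s.2) t ∧ ¬ SeqLE le (Order.succ δ, s.2) t)
    fun X hX => exists_seqLE_not_seqLE_succ (hg.2.2 X hX)
  have hs : LocConst B fun X => (δ X, (g X).2) := (hδ.prodMk hg.2.1).comp fun p => (p.1, p.2.2)
  obtain ⟨C, hC, hgood | hbad⟩ := LocConst.ramsey hg.1
    ((hs.prodMk hs.comp_dropMin).comp fun p => SeqLE le p.1 p.2)
  · refine ⟨C, hC.1.trans hB, fun X => (g X).2 (δ X),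
      ⟨hC.2, (hs.mono hC.1).comp fun p => p.2 p.1, fun X hX hle => ?_⟩, fun X hX => ?_⟩
    · have h1 := hδp X (InfSub.mono hC.1 hX)
      have h2 := hδp _ (dropMin_mem_infSub (InfSub.mono hC.1 hX))
      obtain ⟨φ, h3, h4⟩ := (hgood X hX).succ hle
      exact h1.2.2 ⟨φ, h3, fun i hi =>
        ⟨(h4 i hi).1.trans_le (Order.succ_le_of_lt h2.1), (h4 i hi).2⟩⟩
    · have h1 := hδp X (InfSub.mono hC.1 hX)
      rcases hgf X (InfSub.mono hC.1 hX) with h | h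
      · exact ⟨δ X, h ▸ h1.1, congrArg (fun s => s.2 (δ X)) h⟩
      · exact ⟨δ X, h1.1.trans h.1, congrFun h.2 (δ X)⟩
  · exact absurd (fun X hX => ⟨(hδp X (InfSub.mono hC.1 hX)).1, rfl⟩)
      (hmin C hC.1 _ ⟨hC.2, hs.mono hC.1, hbad⟩)

end SeqLE

/-! ### Sets under injections -/

/-- Some injection from `S` to `S'` maps every element to a larger one. -/
def SetLE {V : Type u} (le : V → V → Prop) (S S' : Set V) : Prop :=
  ∃ f : S → S', Function.Injective f ∧ ∀ c : S, le c (f c)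

open Classical in
/-- An enumeration of a set by ordinals. -/
noncomputable def seqOf {V : Type u} [Nonempty V] (S : Set V) :
    Ordinal.{u} × (Ordinal.{u} → V) :=
  (Ordinal.type (WellOrderingRel (α := S)), fun i =>
    if h : ∃ c : S, Ordinal.typein WellOrderingRel c = i then (h.choose : V)
    else Classical.arbitrary V)

theorem seqOf_typein {V : Type u} [Nonempty V] (S : Set V) (c : S) :
    (seqOf S).2 (Ordinal.typein WellOrderingRel c) = c := by
  have h : ∃ c' : S, Ordinal.typein WellOrderingRel c' = Ordinal.typein WellOrderingRel c := ⟨c, rfl⟩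
  have h' : (seqOf S).2 (Ordinal.typein WellOrderingRel c) = h.choose := dif_pos h
  rw [h', (Ordinal.typein_inj _).1 h.choose_spec]

theorem SetLE.of_seqLE {V : Type u} [Nonempty V] {le : V → V → Prop} {S S' : Set V}
    (h : SeqLE le (seqOf S) (seqOf S')) : SetLE le S S' := by
  obtain ⟨φ, h1, h2⟩ := h
  have hlt : ∀ c : S, Ordinal.typein WellOrderingRel c < (seqOf S).1 := Ordinal.typein_lt_type _
  have h3 : ∀ c : S, ∃ c' : S', Ordinal.typein WellOrderingRel c' =
      φ (Ordinal.typein WellOrderingRel c) := fun c =>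
    Ordinal.typein_surj _ (h2 _ (hlt c)).1
  choose f hf using h3
  have hinj : ∀ c c' : S, WellOrderingRel c c' → f c ≠ f c' := by
    intro c c' hcc' hff
    refine (h1 _ _ ((Ordinal.typein_lt_typein _).2 hcc') (hlt c')).ne ?_
    rw [← hf, ← hf, hff]
  refine ⟨f, fun c c' hff => ?_, fun c => ?_⟩
  · rcases trichotomous_of WellOrderingRel c c' with h | h | h
    · exact absurd hff (hinj _ _ h)
    · exact h
    · exact absurd hff.symm (hinj _ _ h)
  · have := (h2 _ (hlt c)).2
    rwa [← hf, seqOf_typein, seqOf_typein] at this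

/-- A bad array of sets yields a bad array of elements. -/
theorem BadArray.exists_mem {V : Type u} {le : V → V → Prop} {A : Set ℕ} {f : Set ℕ → Set V}
    (hf : BadArray (SetLE le) A f) : ∃ C ⊆ A, ∃ q : Set ℕ → V, BadArray le C q ∧
      ∀ X ∈ InfSub C, q X ∈ f X := by
  have hV : Nonempty V := by
    by_contra hV
    rw [not_nonempty_iff] at hV
    exact hf.2.2 A ⟨subset_rfl, hf.1⟩
      ⟨fun c => isEmptyElim (c : V), fun c => isEmptyElim (c : V), fun c => isEmptyElim (c : V)⟩
  have h : BadArray (SeqLE le) A fun X => seqOf (f X) :=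
    ⟨hf.1, hf.2.1.comp seqOf, fun X hX h => hf.2.2 X hX (SetLE.of_seqLE h)⟩
  obtain ⟨C, hC, q, hq, hqf⟩ := h.exists_entry
  refine ⟨C, hC, q, hq, fun X hX => ?_⟩
  obtain ⟨i, hi, h⟩ := hqf X hX
  obtain ⟨c, rfl⟩ := Ordinal.typein_surj WellOrderingRel hi
  rw [h, seqOf_typein]
  exact c.2

/-! ### The simulation order on the vertices of a forest -/

open Relation (ReflTransGen)

/-- If `E t s`, then the children of `t` can be injected into those of some descendant of `s` in
such a way that `E` persists. -/
def IsSim {V W : Type*} (ch : V → V → Prop) (ch' : W → W → Prop) (E : V → W → Prop) : Prop :=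
  ∀ t s, E t s → ∃ s', ReflTransGen ch' s s' ∧
    ∃ f : {c // ch t c} → {c // ch' s' c}, Function.Injective f ∧ ∀ c : {c // ch t c}, E c (f c)

theorem IsSim.exists_desc {V W : Type*} {ch : V → V → Prop} {ch' : W → W → Prop} {E : V → W → Prop}
    (hE : IsSim ch ch' E) {t t' : V} {s : W} (h : E t s) (ht : ReflTransGen ch t t') :
    ∃ s', ReflTransGen ch' s s' ∧ E t' s' := by
  induction ht with
  | refl => exact ⟨s, .refl, h⟩
  | tail _ hc ih =>
    obtain ⟨s₁, h1, h2⟩ := ih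
    obtain ⟨s₂, h3, f, -, h4⟩ := hE _ _ h2
    exact ⟨f ⟨_, hc⟩, (h1.trans h3).tail (f ⟨_, hc⟩).2, h4 ⟨_, hc⟩⟩

/-- The largest simulation. -/
def SimLE {V : Type u} (ch : V → V → Prop) (t s : V) : Prop := ∃ E, IsSim ch ch E ∧ E t s

/-- `s` is a descendant of `t` which does not simulate `t`. -/
def StrictDesc {V : Type u} (ch : V → V → Prop) (s t : V) : Prop :=
  ReflTransGen ch t s ∧ ¬ SimLE ch t s

section SimLE

variable {V : Type u} {ch : V → V → Prop} {s t w : V}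

theorem isSim_simLE : IsSim ch ch (SimLE ch) := by
  rintro t s ⟨E, hE, hts⟩
  obtain ⟨s', h1, f, hf, h2⟩ := hE t s hts
  exact ⟨s', h1, f, hf, fun c => ⟨E, hE, h2 c⟩⟩

theorem SimLE.refl (t : V) : SimLE ch t t :=
  ⟨Eq, fun t s h => ⟨s, .refl, h ▸ id, by subst h; exact Function.injective_id,
    by subst h; exact fun _ => rfl⟩, rfl⟩

theorem SimLE.trans (h : SimLE ch t s) (h' : SimLE ch s w) : SimLE ch t w := by
  refine ⟨fun a b => ∃ m, SimLE ch a m ∧ SimLE ch m b, ?_, s, h, h'⟩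
  rintro a b ⟨m, h1, h2⟩
  obtain ⟨m', h3, f, hf, h4⟩ := isSim_simLE _ _ h1
  obtain ⟨b', h5, h6⟩ := isSim_simLE.exists_desc h2 h3
  obtain ⟨b'', h7, g, hg, h8⟩ := isSim_simLE _ _ h6
  exact ⟨b'', h5.trans h7, g ∘ f, hg.comp hf, fun c => ⟨f c, h4 c, h8 (f c)⟩⟩

theorem SimLE.of_desc (h : ReflTransGen ch t s) : SimLE ch s t := by
  refine ⟨fun a b => ∃ m, ReflTransGen ch b m ∧ SimLE ch a m, ?_, s, h, .refl s⟩
  rintro a b ⟨m, h1, h2⟩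
  obtain ⟨m', h3, f, hf, h4⟩ := isSim_simLE _ _ h2
  exact ⟨m', h1.trans h3, f, hf, fun c => ⟨f c, .refl, h4 c⟩⟩

theorem StrictDesc.trans (h : StrictDesc ch s t) (h' : StrictDesc ch t w) : StrictDesc ch s w :=
  ⟨h'.1.trans h.1, fun hws => h.2 ((SimLE.of_desc h'.1).trans hws)⟩

/-- Comparison of the children of two vertices, only the number of which matters for those in the
given sets. -/
def ChildrenLE (ch : V → V → Prop) (x z : V × Set V) : Prop :=
  Cardinal.mk {c | ch x.1 c ∧ c ∈ x.2} ≤ Cardinal.mk {c | ch z.1 c ∧ c ∈ z.2} ∧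
    SetLE (SimLE ch) {c | ch x.1 c ∧ c ∉ x.2} {c | ch z.1 c ∧ c ∉ z.2}

theorem ChildrenLE.exists_injective {x z : V × Set V} (h : ChildrenLE ch x z) :
    ∃ f : {c // ch x.1 c} → {c // ch z.1 c}, Function.Injective f ∧
      ∀ c : {c // ch x.1 c}, (c.1 ∈ x.2 ∧ (f c).1 ∈ z.2) ∨ SimLE ch c (f c) := by
  classical
  obtain ⟨⟨e⟩, g, hg, hgle⟩ := h
  have h1 : ∀ c : {c // ch x.1 c}, ∃ c' : {c // ch z.1 c},
      (∃ h : c.1 ∈ x.2, c'.1 = e ⟨c, c.2, h⟩) ∨ ∃ h : c.1 ∉ x.2, c'.1 = g ⟨c, c.2, h⟩ := by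
    intro c
    by_cases h : c.1 ∈ x.2
    · exact ⟨⟨e ⟨c, c.2, h⟩, (e ⟨c, c.2, h⟩).2.1⟩, Or.inl ⟨h, rfl⟩⟩
    · exact ⟨⟨g ⟨c, c.2, h⟩, (g ⟨c, c.2, h⟩).2.1⟩, Or.inr ⟨h, rfl⟩⟩
  choose f hf using h1
  refine ⟨f, fun c c' hcc' => ?_, fun c => ?_⟩
  · have hcc : (f c).1 = (f c').1 := congrArg _ hcc'
    rcases hf c with ⟨h, hc⟩ | ⟨h, hc⟩ <;> rcases hf c' with ⟨h', hc'⟩ | ⟨h', hc'⟩ <;>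
      rw [hc, hc'] at hcc
    · simpa [Subtype.ext_iff] using e.injective (Subtype.ext hcc)
    · exact absurd (hcc ▸ (e ⟨c, c.2, h⟩).2.2) (g ⟨c', c'.2, h'⟩).2.2
    · exact absurd (hcc ▸ (e ⟨c', c'.2, h'⟩).2.2) (g ⟨c, c.2, h⟩).2.2
    · simpa [Subtype.ext_iff] using hg (Subtype.ext hcc)
  · rcases hf c with ⟨h, hc⟩ | ⟨h, hc⟩
    · exact Or.inl ⟨h, hc ▸ (e ⟨c, c.2, h⟩).2.2⟩
    · exact Or.inr (hc ▸ hgle ⟨c, c.2, h⟩)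

theorem exists_badArray_children {A : Set ℕ} {F : Set ℕ → V × Set V}
    (hF : BadArray (ChildrenLE ch) A F) : ∃ C ⊆ A, ∃ d : Set ℕ → V, BadArray (SimLE ch) C d ∧
      ∀ X ∈ InfSub C, ch (F X).1 (d X) ∧ d X ∉ (F X).2 := by
  let card : V × Set V → Cardinal := fun x => Cardinal.mk {c | ch x.1 c ∧ c ∈ x.2}
  obtain ⟨B, hB, hgood | hbad⟩ := LocConst.ramsey hF.1
    ((hF.2.1.prodMk hF.2.1.comp_dropMin).comp fun p => card p.1 ≤ card p.2)
  · have h : BadArray (SetLE (SimLE ch)) B fun X => {c | ch (F X).1 c ∧ c ∉ (F X).2} :=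
      ⟨hB.2, (hF.2.1.mono hB.1).comp fun x : V × Set V => {c | ch x.1 c ∧ c ∉ x.2}, fun X hX h =>
        hF.2.2 X (InfSub.mono hB.1 hX) ⟨hgood X hX, h⟩⟩
    obtain ⟨C, hC, d, hd, hdF⟩ := h.exists_mem
    exact ⟨C, hC.trans hB.1, d, hd, hdF⟩
  · obtain ⟨_, ⟨X, hX, rfl⟩, hmin⟩ := Cardinal.lt_wf.has_min ((fun X => card (F X)) '' InfSub B)
      ⟨_, B, ⟨subset_rfl, hB.2⟩, rfl⟩
    exact absurd (not_le.1 (hbad X hX)) (hmin _ ⟨_, dropMin_mem_infSub hX, rfl⟩)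

theorem SimLE.of_forall_childrenLE
    (h : ∀ x, ReflTransGen ch t x → SimLE ch t x → ∃ z, SimLE ch s z ∧ ReflTransGen ch s z ∧
      ChildrenLE ch (x, {c | SimLE ch t c}) (z, {c | SimLE ch s c})) : SimLE ch t s := by
  refine ⟨fun a b => (ReflTransGen ch t a ∧ SimLE ch t a ∧ SimLE ch s b) ∨ SimLE ch a b, ?_,
    Or.inl ⟨.refl, .refl t, .refl s⟩⟩
  rintro a b (⟨h1, h2, h3⟩ | hab)
  · obtain ⟨z, hsz, hz, hle⟩ := h a h1 h2
    obtain ⟨f, hf, hfc⟩ := hle.exists_injective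
    obtain ⟨b', hb, hzb⟩ := isSim_simLE.exists_desc h3 hz
    obtain ⟨b'', hb', g, hg, hgc⟩ := isSim_simLE _ _ hzb
    refine ⟨b'', hb.trans hb', g ∘ f, hg.comp hf, fun c => ?_⟩
    rcases hfc c with ⟨hc, hc'⟩ | hc
    · exact Or.inl ⟨h1.tail c.2, hc, SimLE.trans hc' (hgc _)⟩
    · exact Or.inr (hc.trans (hgc _))
  · obtain ⟨b', hb, f, hf, hfc⟩ := isSim_simLE _ _ hab
    exact ⟨b', hb, f, hf, fun c => Or.inr (hfc c)⟩

instance : IsTrans V fun x y => StrictDesc ch x y ∧ Acc (StrictDesc ch) y :=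
  ⟨fun _ _ _ h h' => ⟨h.1.trans h'.1, h'.2⟩⟩

instance : IsWellFounded V fun x y => StrictDesc ch x y ∧ Acc (StrictDesc ch) y := by
  refine ⟨⟨fun x => ⟨x, fun y hy => ?_⟩⟩⟩
  have hacc := hy.2.inv hy.1
  clear hy
  induction hacc with
  | intro y _ ih => exact ⟨y, fun z hz => ih z hz.1⟩

theorem not_badArray_of_acc {A : Set ℕ} {f : Set ℕ → V} (hf : BadArray (SimLE ch) A f) :
    ¬ ∀ X ∈ InfSub A, Acc (StrictDesc ch) (f X) := by
  intro hacc
  obtain ⟨B, hB, g, hg, hgf, hmin⟩ := hf.exists_minimal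
    (R := fun x y => StrictDesc ch x y ∧ Acc (StrictDesc ch) y)
    fun x y z h h' => h.trans (SimLE.of_desc h'.1.1)
  have hgacc : ∀ X ∈ InfSub B, Acc (StrictDesc ch) (g X) := by
    intro X hX
    rcases hgf X hX with h | h
    · exact h ▸ hacc X (InfSub.mono hB hX)
    · exact h.2.inv h.1
  have : Nonempty V := ⟨f A⟩
  obtain ⟨x, hx, hxp⟩ := hg.2.1.exists_choice
    (fun t s x => ReflTransGen ch t x ∧ SimLE ch t x ∧
      ∀ z, SimLE ch s z → ReflTransGen ch s z →
        ¬ ChildrenLE ch (x, {c | SimLE ch t c}) (z, {c | SimLE ch s c}))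
    fun X hX => by
      by_contra! hcon
      exact hg.2.2 X hX (SimLE.of_forall_childrenLE hcon)
  have hF : BadArray (ChildrenLE ch) B fun X => (x X, {c | SimLE ch (g X) c}) :=
    ⟨hg.1, (hx.prodMk hg.2.1).comp fun p => (p.1, {c | SimLE ch p.2 c}), fun X hX =>
      (hxp X hX).2.2 _ (hxp _ (dropMin_mem_infSub hX)).2.1 (hxp _ (dropMin_mem_infSub hX)).1⟩
  obtain ⟨C, hC, d, hd, hdF⟩ := exists_badArray_children hF
  exact hmin C hC d hd fun X hX =>
    have hX' := InfSub.mono hC hX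
    ⟨⟨(hxp X hX').1.tail (hdF X hX).1, (hdF X hX).2⟩, hgacc X hX'⟩

theorem locConst_sInf {Q : Type*} {A : Set ℕ} (p : ℕ → Q) : LocConst A fun X => p (sInf X) :=
  fun _ hX => ⟨_, fun _ _ h => congrArg p <|
    sInf_eq_of_agree hX.2.nonempty fun i hi => h i (Nat.lt_succ_of_le hi)⟩

/-- There is a vertex above which all inaccessible vertices have the same behaviour, unless every
vertex is accessible. -/
theorem exists_uniform (ht : ¬ Acc (StrictDesc ch) t) :
    ∃ x, ¬ Acc (StrictDesc ch) x ∧ ∀ y, ReflTransGen ch x y → ¬ Acc (StrictDesc ch) y →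
      ∀ x', ReflTransGen ch x x' → ¬ Acc (StrictDesc ch) x' → ∃ z, ReflTransGen ch y z ∧
        ChildrenLE ch (x', {c | ¬ Acc (StrictDesc ch) c}) (z, {c | ¬ Acc (StrictDesc ch) c}) := by
  by_contra! hcon
  have step : ∀ x : {x // ¬ Acc (StrictDesc ch) x}, ∃ (y : {x // ¬ Acc (StrictDesc ch) x}) (x' : V),
      ReflTransGen ch x.1 y.1 ∧ ReflTransGen ch x.1 x' ∧ ∀ z, ReflTransGen ch y.1 z →
        ¬ ChildrenLE ch (x', {c | ¬ Acc (StrictDesc ch) c}) (z, {c | ¬ Acc (StrictDesc ch) c}) := by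
    rintro ⟨x, hx⟩
    obtain ⟨y, hxy, hy, x', hxx', -, h⟩ := hcon x hx
    exact ⟨⟨y, hy⟩, x', hxy, hxx', h⟩
  choose next p hnext hp hbad using step
  let w : ℕ → {x // ¬ Acc (StrictDesc ch) x} := fun n => Nat.rec ⟨t, ht⟩ (fun _ => next) n
  have hw : ∀ n m, n ≤ m → ReflTransGen ch (w n).1 (w m).1 := by
    intro n m hnm
    induction hnm with
    | refl => exact .refl
    | step _ ih => exact ih.trans (hnext _)
  have hF : BadArray (ChildrenLE ch) Set.univ fun X =>
      (p (w (sInf X)), {c | ¬ Acc (StrictDesc ch) c}) := by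
    refine ⟨Set.infinite_univ, locConst_sInf fun n => (p (w n), {c | ¬ Acc (StrictDesc ch) c}),
      fun X hX => hbad _ _ ((hw (sInf X + 1) _ ?_).trans (hp _))⟩
    have h := Nat.sInf_mem (dropMin_mem_infSub hX).2.nonempty
    exact lt_of_le_of_ne (Nat.sInf_le h.1) fun h' => h.2 h'.symm
  obtain ⟨C, -, d, hd, hdF⟩ := exists_badArray_children hF
  exact not_badArray_of_acc hd fun X hX => not_not.1 (hdF X hX).2

theorem acc_strictDesc (t : V) : Acc (StrictDesc ch) t := by
  by_contra ht
  obtain ⟨x, hx, hunif⟩ := exists_uniform ht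
  refine hx ⟨x, fun y hy => ?_⟩
  by_contra hy'
  refine hy.2 ⟨fun a b => (ReflTransGen ch x a ∧ ¬ Acc (StrictDesc ch) a ∧ ReflTransGen ch x b ∧
    ¬ Acc (StrictDesc ch) b) ∨ SimLE ch a b, ?_, Or.inl ⟨.refl, hx, hy.1, hy'⟩⟩
  rintro a b (⟨h1, h2, h3, h4⟩ | hab)
  · obtain ⟨z, hz, hle⟩ := hunif b h3 h4 a h1 h2
    obtain ⟨f, hf, hfc⟩ := hle.exists_injective
    refine ⟨z, hz, f, hf, fun c => ?_⟩
    rcases hfc c with ⟨hc, hc'⟩ | hc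
    · exact Or.inl ⟨h1.tail c.2, hc, (h3.trans hz).tail (f c).2, hc'⟩
    · exact Or.inr hc
  · obtain ⟨b', hb, f, hf, hfc⟩ := isSim_simLE _ _ hab
    exact ⟨b', hb, f, hf, fun c => Or.inr (hfc c)⟩

end SimLE

/-! ### Rooted trees through their child relation -/

/-- `ch` is the child relation and `d` a depth function of the rooted tree `T`. -/
structure IsChildRel {V : Type*} (T : RootedGraph V) (ch : V → V → Prop) (d : V → ℕ) : Prop where
  adj_iff : ∀ a b, T.graph.Adj a b ↔ ch a b ∨ ch b a
  parent_unique : ∀ a b c, ch a c → ch b c → a = b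
  root_desc : ∀ a, ReflTransGen ch T.root a
  depth : ∀ a b, ch a b → d b = d a + 1

theorem SimpleGraph.IsTree.isChildRel {V : Type*} {T : RootedGraph V} (hT : T.graph.IsTree) :
    IsChildRel T (fun a b => T.graph.Adj a b ∧ T.graph.dist T.root b = T.graph.dist T.root a + 1)
      (T.graph.dist T.root) where
  adj_iff a b := by
    refine ⟨fun h => ?_, fun h => h.elim And.left fun h => h.1.symm⟩
    have h1 := hT.dist_ne_of_adj T.root h
    have h2 := h.diff_dist_adj (u := T.root)
    rcases h2 with h2 | h2 | h2
    · omega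
    · exact Or.inl ⟨h, h2⟩
    · exact Or.inr ⟨h.symm, by omega⟩
  parent_unique a b c := by
    rintro ⟨h1, h2⟩ ⟨h3, h4⟩
    obtain ⟨p, hp⟩ := hT.1.exists_walk_length_eq_dist T.root a
    obtain ⟨q, hq⟩ := hT.1.exists_walk_length_eq_dist T.root b
    have hp' := (p.concat h1).isPath_of_length_eq_dist (by simp [hp, h2])
    have hq' := (q.concat h3).isPath_of_length_eq_dist (by simp [hq, h4])
    exact (SimpleGraph.Walk.concat_inj ((hT.existsUnique_path _ _).unique hp' hq')).1
  root_desc a := by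
    induction h : T.graph.dist T.root a generalizing a with
    | zero => rw [hT.1.dist_eq_zero_iff.1 h]
    | succ n ih =>
      obtain ⟨w, hw⟩ := hT.1.exists_walk_length_eq_dist T.root a
      have hnil : ¬ w.Nil := fun hn => by
        have := SimpleGraph.Walk.length_eq_zero_iff.2 hn
        omega
      have h1 := w.adj_penultimate hnil
      have h2 := SimpleGraph.dist_le w.dropLast
      have h3 := w.length_dropLast_add_one hnil
      have h4 := h1.diff_dist_adj (u := T.root)
      have h5 : T.graph.dist T.root w.penultimate = n := by omega
      exact (ih _ h5).tail ⟨h1, by omega⟩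
  depth _ _ h := h.2

namespace IsChildRel

variable {V : Type*} {T : RootedGraph V} {ch : V → V → Prop} {d : V → ℕ} {a b c e : V}

theorem depth_lt (h : IsChildRel T ch d) (hab : ReflTransGen ch a b) (hne : a ≠ b) :
    d a < d b := by
  induction hab with
  | refl => exact absurd rfl hne
  | @tail x y _ hxy ih =>
    have := h.depth _ _ hxy
    by_cases hax : a = x
    · subst hax; omega
    · have := ih hax
      omega

theorem antisymm (h : IsChildRel T ch d) (hab : ReflTransGen ch a b) (hba : ReflTransGen ch b a) :
    a = b := by
  by_contra hne
  exact lt_asymm (h.depth_lt hab hne) (h.depth_lt hba (Ne.symm hne))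

theorem not_desc_of_child (h : IsChildRel T ch d) (hab : ch a b) : ¬ ReflTransGen ch b a := by
  intro hba
  obtain rfl := h.antisymm (.single hab) hba
  have := h.depth _ _ hab
  omega

theorem eq_or_desc (h : IsChildRel T ch d) (hac : ReflTransGen ch a c) (hbc : ch b c) :
    a = c ∨ ReflTransGen ch a b := by
  rcases hac.cases_tail with hac | ⟨b', h1, h2⟩
  · exact Or.inl hac.symm
  · obtain rfl := h.parent_unique _ _ _ hbc h2
    exact Or.inr h1

theorem comparable (h : IsChildRel T ch d) (hac : ReflTransGen ch a c)
    (hbc : ReflTransGen ch b c) : ReflTransGen ch a b ∨ ReflTransGen ch b a := by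
  induction hbc with
  | refl => exact Or.inl hac
  | tail hb hc ih =>
    rcases h.eq_or_desc hac hc with rfl | h1
    · exact Or.inr (hb.tail hc)
    · exact ih h1

theorem siblings (h : IsChildRel T ch d) (hb : ch a b) (hc : ch a c) (hbe : ReflTransGen ch b e)
    (hce : ReflTransGen ch c e) : b = c := by
  rcases h.comparable hbe hce with h1 | h1
  · exact (h.eq_or_desc h1 hc).resolve_right (h.not_desc_of_child hb)
  · exact ((h.eq_or_desc h1 hb).resolve_right (h.not_desc_of_child hc)).symm

theorem exists_path (h : IsChildRel T ch d) (hab : ReflTransGen ch a b) :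
    ∃ w : T.graph.Walk a b, w.IsPath ∧
      ∀ e, e ∈ w.support ↔ ReflTransGen ch a e ∧ ReflTransGen ch e b := by
  induction hab with
  | refl =>
    refine ⟨.nil, .nil, fun e => ?_⟩
    rw [SimpleGraph.Walk.support_nil, List.mem_singleton]
    exact ⟨fun he => he ▸ ⟨.refl, .refl⟩, fun he => h.antisymm he.2 he.1⟩
  | @tail x y hax hxy ih =>
    obtain ⟨w, hw, hsupp⟩ := ih
    have hadj := (h.adj_iff _ _).2 (Or.inl hxy)
    refine ⟨w.concat hadj, hw.concat (fun hy => ?_) hadj, fun e => ?_⟩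
    · exact h.not_desc_of_child hxy ((hsupp _).1 hy).2
    · rw [SimpleGraph.Walk.support_concat, List.mem_append, List.mem_singleton, hsupp]
      constructor
      · rintro (⟨h1, h2⟩ | rfl)
        · exact ⟨h1, h2.tail hxy⟩
        · exact ⟨hax.tail hxy, .refl⟩
      · rintro ⟨h1, h2⟩
        exact (h.eq_or_desc h2 hxy).symm.imp (fun h3 => ⟨h1, h3⟩) id

theorem desc_of_mem_support (h : IsChildRel T ch d) (w : T.graph.Walk a b) (hw : w.IsPath)
    (hpar : ∀ e ∈ w.support, ¬ ch e a) : ∀ e ∈ w.support, ReflTransGen ch e b := by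
  suffices hs : ReflTransGen ch a b ∧ ∀ e ∈ w.support, ReflTransGen ch e b from hs.2
  induction w with
  | nil => simp [ReflTransGen.refl]
  | @cons x y z hxy p ih =>
    rw [SimpleGraph.Walk.cons_isPath_iff] at hw
    have hch : ch x y := ((h.adj_iff _ _).1 hxy).resolve_right (hpar y (by simp))
    obtain ⟨h1, h2⟩ := ih hw.1 fun e he hey => hw.2 (h.parent_unique _ _ _ hch hey ▸ he)
    have h3 := ReflTransGen.head hch h1
    refine ⟨h3, fun e he => ?_⟩
    rw [SimpleGraph.Walk.support_cons, List.mem_cons] at he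
    rcases he with rfl | he
    · exact h3
    · exact h2 e he

theorem treeLE_iff (h : IsChildRel T ch d) :
    treeLE T.graph T.root a b ↔ ReflTransGen ch a b := by
  constructor
  · rintro ⟨w, hw, ha⟩
    exact h.desc_of_mem_support w hw (fun e _ he => h.not_desc_of_child he (h.root_desc e)) a ha
  · intro hab
    obtain ⟨w, hw, hsupp⟩ := h.exists_path (h.root_desc b)
    exact ⟨w, hw, (hsupp a).2 ⟨h.root_desc a, hab⟩⟩

theorem mem_upSet (h : IsChildRel T ch d) : b ∈ upSet T a ↔ ReflTransGen ch a b := by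
  rw [upSet, Set.mem_insert_iff, Set.mem_ofPred_eq, h.treeLE_iff]
  exact ⟨fun hb => hb.elim (fun hb => hb ▸ .refl) id, Or.inr⟩

theorem subtreeAt (h : IsChildRel T ch d) (t : V) :
    IsChildRel (subtreeAt T t) (fun a b => ch a.1 b.1) (fun a => d a.1) where
  adj_iff a b := h.adj_iff a.1 b.1
  parent_unique a b c h1 h2 := Subtype.ext (h.parent_unique _ _ _ h1 h2)
  root_desc := by
    have key : ∀ a, ReflTransGen ch t a → ∀ ha : a ∈ upSet T t,
        ReflTransGen (fun a b : upSet T t => ch a.1 b.1) (_root_.subtreeAt T t).root ⟨a, ha⟩ := by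
      intro a hta
      induction hta with
      | refl => exact fun _ => .refl
      | tail hx hxy ih => exact fun _ => .tail (ih (h.mem_upSet.2 hx)) hxy
    exact fun a => key a (h.mem_upSet.1 a.2) a.2
  depth a b := h.depth a.1 b.1

/-- Recursion along the tree. -/
theorem exists_rec {W : Type*} (h : IsChildRel T ch d) (r' : W) (g : V → W → V → W) :
    ∃ slot : V → W, slot T.root = r' ∧ ∀ a c, ch a c → slot c = g a (slot a) c := by
  classical
  let S : ℕ → V → W := fun n => Nat.rec (fun _ => r') (fun _ σ c =>
    if hc : ∃ a, ch a c then g hc.choose (σ hc.choose) c else r') n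
  refine ⟨fun v => S (d v) v, ?_, fun a c hac => ?_⟩
  · have hroot : ¬ ∃ a, ch a T.root := fun ⟨a, ha⟩ => h.not_desc_of_child ha (h.root_desc a)
    change S (d T.root) T.root = r'
    cases d T.root with
    | zero => rfl
    | succ n => exact dif_neg hroot
  · have hc : ∃ a, ch a c := ⟨a, hac⟩
    have ha : hc.choose = a := h.parent_unique _ _ _ hc.choose_spec hac
    change S (d c) c = g a (S (d a) a) c
    rw [h.depth _ _ hac]
    refine (dif_pos hc).trans ?_
    rw [ha]

end IsChildRel

/-! ### Embeddings from simulations -/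

/-- `φ` maps every vertex `a` to a descendant of `slot a`, and `slot` maps the children of `a`
injectively to children of `φ a`. -/
structure IsSlotting {V W : Type*} (ch : V → V → Prop) (ch' : W → W → Prop) (slot φ : V → W) :
    Prop where
  desc : ∀ a, ReflTransGen ch' (slot a) (φ a)
  child : ∀ a c, ch a c → ch' (φ a) (slot c)
  inj : ∀ a b c, ch a b → ch a c → slot b = slot c → b = c

theorem IsSim.exists_isSlotting {V W : Type*} {T : RootedGraph V} {S : RootedGraph W}
    {ch : V → V → Prop} {d : V → ℕ} {ch' : W → W → Prop} {E : V → W → Prop}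
    (hT : IsChildRel T ch d) (hE : IsSim ch ch' E) (hroot : E T.root S.root) :
    ∃ slot φ : V → W, IsSlotting ch ch' slot φ := by
  classical
  choose up hup f hf hfE using hE
  let g : V → W → V → W := fun a s c =>
    if h : E a s ∧ ch a c then f a s h.1 ⟨c, h.2⟩ else S.root
  obtain ⟨slot, hs0, hs⟩ := hT.exists_rec S.root g
  have hg : ∀ a c (h : E a (slot a)) (hc : ch a c), slot c = f a (slot a) h ⟨c, hc⟩ :=
    fun a c h hc => (hs a c hc).trans (dif_pos ⟨h, hc⟩)
  have hslot : ∀ a, E a (slot a) := by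
    intro a
    induction hT.root_desc a with
    | refl => rwa [hs0]
    | tail _ hxy ih =>
      rw [hg _ _ ih hxy]
      exact hfE _ _ _ ⟨_, hxy⟩
  refine ⟨slot, fun a => up a (slot a) (hslot a), fun a => hup _ _ _, fun a c hc => ?_,
    fun a b c hb hc hbc => ?_⟩
  · rw [hg a c (hslot a) hc]
    exact (f a (slot a) (hslot a) ⟨c, hc⟩).2
  · rw [hg a b (hslot a) hb, hg a c (hslot a) hc] at hbc
    exact congrArg Subtype.val (hf _ _ _ (Subtype.ext hbc))

namespace IsSlotting

variable {V W : Type*} {T : RootedGraph V} {S : RootedGraph W} {ch : V → V → Prop} {d : V → ℕ}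
  {ch' : W → W → Prop} {d' : W → ℕ} {slot φ : V → W} {a b c x : V} {w : W}

theorem desc_slot (h : IsSlotting ch ch' slot φ) (hcb : ReflTransGen ch c b) :
    ReflTransGen ch' (slot c) (slot b) := by
  induction hcb with
  | refl => exact .refl
  | tail _ hxy ih => exact ih.trans ((h.desc _).tail (h.child _ _ hxy))

theorem map_desc (h : IsSlotting ch ch' slot φ) (hab : ReflTransGen ch a b) :
    ReflTransGen ch' (φ a) (φ b) := by
  rcases hab.cases_head with rfl | ⟨c, hac, hcb⟩
  · exact .refl
  · exact (ReflTransGen.single (h.child _ _ hac)).trans ((h.desc_slot hcb).trans (h.desc b))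

theorem map_ne (h : IsSlotting ch ch' slot φ) (hS : IsChildRel S ch' d')
    (hab : ReflTransGen ch a b) (hne : a ≠ b) : φ a ≠ φ b := by
  rcases hab.cases_head with rfl | ⟨c, hac, hcb⟩
  · exact absurd rfl hne
  · intro heq
    refine hS.not_desc_of_child (h.child _ _ hac) ?_
    rw [heq]
    exact (h.desc_slot hcb).trans (h.desc b)

theorem comparable (h : IsSlotting ch ch' slot φ) (hT : IsChildRel T ch d)
    (hS : IsChildRel S ch' d') (ha : ReflTransGen ch' (slot a) w)
    (hb : ReflTransGen ch' (slot b) w) : ReflTransGen ch a b ∨ ReflTransGen ch b a := by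
  induction hT.root_desc b with
  | refl => exact Or.inr (hT.root_desc a)
  | @tail x y _ hxy ih =>
    have hslot := ReflTransGen.tail (h.desc x) (h.child _ _ hxy)
    rcases ih (hslot.trans hb) with h1 | h1
    · exact Or.inl (h1.tail hxy)
    · rcases h1.cases_head with rfl | ⟨z, hxz, hza⟩
      · exact Or.inl (.single hxy)
      · have := hS.siblings (h.child _ _ hxy) (h.child _ _ hxz) hb ((h.desc_slot hza).trans ha)
        exact Or.inr (h.inj _ _ _ hxy hxz this ▸ hza)

theorem injective (h : IsSlotting ch ch' slot φ) (hT : IsChildRel T ch d)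
    (hS : IsChildRel S ch' d') : Function.Injective φ := by
  intro a b hab
  by_contra hne
  rcases h.comparable hT hS (h.desc a) (hab ▸ h.desc b) with h1 | h1
  · exact h.map_ne hS h1 hne hab
  · exact h.map_ne hS h1 (Ne.symm hne) hab.symm

/-- Images of vertices are not in the interior of the image of an edge. -/
theorem eq_of_map_mem (h : IsSlotting ch ch' slot φ) (hT : IsChildRel T ch d)
    (hS : IsChildRel S ch' d') (hac : ch a c) (hax : ReflTransGen ch' (φ a) (φ x))
    (hxc : ReflTransGen ch' (φ x) (φ c)) : x = a ∨ x = c := by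
  have hinj := h.injective hT hS
  have h1 : ReflTransGen ch a x := by
    rcases h.comparable hT hS ((h.desc a).trans hax) (h.desc x) with h1 | h1
    · exact h1
    · rw [hinj (hS.antisymm hax (h.map_desc h1))]
  have h2 : ReflTransGen ch x c := by
    rcases h.comparable hT hS ((h.desc x).trans hxc) (h.desc c) with h2 | h2
    · exact h2
    · rw [hinj (hS.antisymm hxc (h.map_desc h2))]
  rcases hT.eq_or_desc h2 hac with h3 | h3
  · exact Or.inr h3
  · exact Or.inl (hT.antisymm h3 h1)

theorem slot_desc_of_mem (h : IsSlotting ch ch' slot φ) (hS : IsChildRel S ch' d') (hac : ch a c)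
    (haw : ReflTransGen ch' (φ a) w) (hwc : ReflTransGen ch' w (φ c)) (hne : w ≠ φ a) :
    ReflTransGen ch' (slot c) w := by
  rcases hS.comparable (h.desc c) hwc with h1 | h1
  · exact h1
  · rcases hS.eq_or_desc h1 (h.child _ _ hac) with rfl | h2
    · exact .refl
    · exact absurd (hS.antisymm h2 haw) hne

/-- The images of distinct edges have disjoint interiors. -/
theorem eq_of_mem_of_mem (h : IsSlotting ch ch' slot φ) (hT : IsChildRel T ch d)
    (hS : IsChildRel S ch' d') (hac : ch a c) (hbx : ch b x) (hne : ¬ (a = b ∧ c = x))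
    (h1 : ReflTransGen ch' (φ a) w) (h2 : ReflTransGen ch' w (φ c))
    (h3 : ReflTransGen ch' (φ b) w) (h4 : ReflTransGen ch' w (φ x)) : w = φ a ∨ w = φ c := by
  by_contra! hcon
  have hint : ∀ y, w ≠ φ y := by
    rintro y rfl
    rcases h.eq_of_map_mem hT hS hac h1 h2 with rfl | rfl
    · exact hcon.1 rfl
    · exact hcon.2 rfl
  have h5 := h.slot_desc_of_mem hS hac h1 h2 (hint a)
  have h6 := h.slot_desc_of_mem hS hbx h3 h4 (hint b)
  rcases h.comparable hT hS h5 h6 with h7 | h7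
  · rcases hT.eq_or_desc h7 hbx with rfl | h8
    · exact hne ⟨hT.parent_unique _ _ _ hac hbx, rfl⟩
    · exact hint c (hS.antisymm h2 ((h.map_desc h8).trans h3))
  · rcases hT.eq_or_desc h7 hac with rfl | h8
    · exact hne ⟨hT.parent_unique _ _ _ hac hbx, rfl⟩
    · exact hint x (hS.antisymm h4 ((h.map_desc h8).trans h1))

open Classical in
theorem rootedLE {V : Type u} {W : Type v} {T : RootedGraph V} {S : RootedGraph W}
    {ch : V → V → Prop} {d : V → ℕ} {ch' : W → W → Prop} {d' : W → ℕ} {slot φ : V → W}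
    (h : IsSlotting ch ch' slot φ) (hT : IsChildRel T ch d) (hS : IsChildRel S ch' d') :
    RootedLE T S := by
  choose P hP hPs using fun (a b : V) (hab : ch a b) => hS.exists_path (h.map_desc (.single hab))
  have hpar : ∀ {a b : V}, T.graph.Adj a b → ¬ ch a b → ch b a := fun hab hn =>
    ((hT.adj_iff _ _).1 hab).resolve_left hn
  let path : ∀ ⦃a b : V⦄, T.graph.Adj a b → S.graph.Walk (φ a) (φ b) := fun a b hab =>
    if hc : ch a b then P a b hc else (P b a (hpar hab hc)).reverse
  have hpath : ∀ ⦃a b : V⦄ (hab : T.graph.Adj a b), ∃ x y, ch x y ∧ s(x, y) = s(a, b) ∧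
      ∀ w, w ∈ (path hab).support ↔ ReflTransGen ch' (φ x) w ∧ ReflTransGen ch' w (φ y) := by
    intro a b hab
    by_cases hc : ch a b
    · refine ⟨a, b, hc, rfl, fun w => ?_⟩
      simp only [path, dif_pos hc, hPs]
    · refine ⟨b, a, hpar hab hc, Sym2.eq_swap, fun w => ?_⟩
      simp only [path, dif_neg hc, SimpleGraph.Walk.support_reverse, List.mem_reverse, hPs]
  refine ⟨⟨φ, h.injective hT hS, path, fun a b hab => ?_, fun a b hab => ?_, ?_, ?_⟩, ?_⟩
  · by_cases hc : ch a b
    · simp only [path, dif_pos hc, hP]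
    · simp only [path, dif_neg hc]
      exact (hP _ _ _).reverse
  · by_cases hc : ch a b
    · have hc' : ¬ ch b a := fun hc' => hT.not_desc_of_child hc (.single hc')
      simp only [path, dif_pos hc, dif_neg hc']
    · have hc' := hpar hab hc
      simp only [path, dif_neg hc, dif_pos hc', SimpleGraph.Walk.reverse_reverse]
  · rintro a b hab w hw hwa hwb x rfl
    obtain ⟨y, z, hyz, hs, hmem⟩ := hpath hab
    have := h.eq_of_map_mem hT hS hyz ((hmem _).1 hw).1 ((hmem _).1 hw).2
    rcases Sym2.eq_iff.1 hs with ⟨rfl, rfl⟩ | ⟨rfl, rfl⟩ <;> rcases this with rfl | rfl <;> simp_all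
  · intro a b a' b' hab hab' hne w hw hw'
    obtain ⟨y, z, hyz, hs, hmem⟩ := hpath hab
    obtain ⟨y', z', hyz', hs', hmem'⟩ := hpath hab'
    rw [hmem] at hw
    rw [hmem'] at hw'
    have := h.eq_of_mem_of_mem hT hS hyz hyz'
      (fun heq => hne (by rw [← hs, ← hs', heq.1, heq.2])) hw.1 hw.2 hw'.1 hw'.2
    rcases Sym2.eq_iff.1 hs with ⟨rfl, rfl⟩ | ⟨rfl, rfl⟩
    · exact this
    · exact this.symm
  · intro a b hab
    exact hS.treeLE_iff.2 (h.map_desc (hT.treeLE_iff.1 hab))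

end IsSlotting

/-! ### Nash-Williams ranks -/

/-- `ι` identifies the rooted tree `T` with the part of the forest `ch` above `ι T.root`. -/
structure IsRep {V P : Type*} (ch : V → V → Prop) (d : V → ℕ) (T : RootedGraph P) (ι : P → V) :
    Prop where
  inj : Function.Injective ι
  isChildRel : IsChildRel T (fun a b => ch (ι a) (ι b)) fun a => d (ι a)
  mem_range : ∀ a c, ch (ι a) c → ∃ b, ι b = c

namespace IsRep

variable {V : Type u} {ch : V → V → Prop} {d : V → ℕ}

theorem subtreeAt {P : Type*} {T : RootedGraph P} {ι : P → V} (h : IsRep ch d T ι) (x : P) :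
    IsRep ch d (subtreeAt T x) fun a => ι a.1 where
  inj := h.inj.comp Subtype.val_injective
  isChildRel := h.isChildRel.subtreeAt x
  mem_range a c hac := by
    obtain ⟨b, rfl⟩ := h.mem_range _ _ hac
    exact ⟨⟨b, h.isChildRel.mem_upSet.2 ((h.isChildRel.mem_upSet.1 a.2).tail hac)⟩, rfl⟩

theorem desc_map {P : Type*} {T : RootedGraph P} {ι : P → V} (h : IsRep ch d T ι) (x : P) :
    ReflTransGen ch (ι T.root) (ι x) :=
  (h.isChildRel.root_desc x).lift ι fun _ _ => id

theorem exists_lift {P : Type*} {T : RootedGraph P} {ι : P → V} (h : IsRep ch d T ι) {x : P} {s : V}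
    (hs : ReflTransGen ch (ι x) s) :
    ∃ y, ι y = s ∧ ReflTransGen (fun a b => ch (ι a) (ι b)) x y := by
  induction hs with
  | refl => exact ⟨x, rfl, .refl⟩
  | tail _ hc ih =>
    obtain ⟨y, rfl, hxy⟩ := ih
    obtain ⟨z, rfl⟩ := h.mem_range _ _ hc
    exact ⟨z, rfl, hxy.tail hc⟩

theorem rootedLE {P : Type u} {P' : Type v} {T : RootedGraph P} {T' : RootedGraph P'} {ι : P → V}
    {ι' : P' → V} (h : IsRep ch d T ι) (h' : IsRep ch d T' ι')
    (hle : SimLE ch (ι T.root) (ι' T'.root)) : RootedLE T T' := by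
  have hsim : IsSim (fun a b => ch (ι a) (ι b)) (fun a b => ch (ι' a) (ι' b))
      fun a b => SimLE ch (ι a) (ι' b) := by
    intro a b hab
    obtain ⟨s, hs, f, hf, hfc⟩ := isSim_simLE _ _ hab
    obtain ⟨b', rfl, hb⟩ := h'.exists_lift hs
    choose g hg using fun c : {c // ch (ι a) (ι c)} => h'.mem_range _ _ (f ⟨ι c, c.2⟩).2
    refine ⟨b', hb, fun c => ⟨g c, by
      dsimp only
      rw [hg]
      exact (f ⟨ι c, c.2⟩).2⟩, fun c c' hcc' => ?_, fun c => ?_⟩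
    · have h1 : g c = g c' := congrArg Subtype.val hcc'
      have h2 : f ⟨ι c, c.2⟩ = f ⟨ι c', c'.2⟩ := Subtype.ext (by rw [← hg, ← hg, h1])
      exact Subtype.ext (h.inj (congrArg Subtype.val (hf h2)))
    · simp only [hg]
      exact hfc ⟨ι c, c.2⟩
  obtain ⟨slot, φ, hφ⟩ := hsim.exists_isSlotting h.isChildRel hle
  exact hφ.rootedLE h.isChildRel h'.isChildRel

end IsRep

theorem hasNWRankAux_iff (α : Ordinal.{u}) (p : RTreeSig.{u}) :
    HasNWRankAux α p ↔ (∀ β < α, ¬ HasNWRankAux β p) ∧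
      ∀ t : p.1, RTequiv (subtreeSig p t) p ∨ ∃ β < α, HasNWRankAux β (subtreeSig p t) := by
  unfold HasNWRankAux
  rw [WellFounded.fix_eq]
  simp only [exists_prop]

theorem exists_hasNWRankAux_le {p : RTreeSig.{u}} {β : Ordinal.{u}}
    (h : ∀ t : p.1, RTequiv (subtreeSig p t) p ∨ ∃ γ < β, HasNWRankAux γ (subtreeSig p t)) :
    ∃ α ≤ β, HasNWRankAux α p := by
  by_cases hex : ∃ α < β, HasNWRankAux α p
  · obtain ⟨α, hα, hp⟩ := hex
    exact ⟨α, hα.le, hp⟩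
  · exact ⟨β, le_rfl, (hasNWRankAux_iff β p).2 ⟨fun α hα hp => hex ⟨α, hα, hp⟩, h⟩⟩

theorem IsRep.exists_hasNWRankAux {κ : Cardinal.{u}} (hκ : Cardinal.aleph0 ≤ κ) {V : Type u}
    {ch : V → V → Prop} {d : V → ℕ} (t : V) :
    ∀ (p : RTreeSig.{u}) (ι : p.1 → V), IsRep ch d p.2 ι → ι p.2.root = t → Cardinal.mk p.1 ≤ κ →
      ∃ α < (Order.succ κ).ord, HasNWRankAux α p := by
  induction acc_strictDesc (ch := ch) t with
  | intro t _ ih =>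
    rintro p ι h rfl hp
    have key : ∀ x : p.1, ∃ γ < (Order.succ κ).ord, RTequiv (subtreeSig p x) p ∨
        HasNWRankAux γ (subtreeSig p x) := by
      intro x
      have hx := h.subtreeAt x
      by_cases hle : SimLE ch (ι p.2.root) (ι x)
      · refine ⟨0, ?_, Or.inl ⟨hx.rootedLE h (SimLE.of_desc (h.desc_map x)), h.rootedLE hx hle⟩⟩
        rw [Cardinal.lt_ord, Ordinal.card_zero]
        exact Order.bot_lt_succ κ
      · obtain ⟨γ, hγ, hr⟩ := ih (ι x) ⟨h.desc_map x, hle⟩ (subtreeSig p x) _ hx rfl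
          ((Cardinal.mk_le_of_injective Subtype.val_injective).trans hp)
        exact ⟨γ, hγ, Or.inr hr⟩
    choose γ hγ hr using key
    have hreg := Cardinal.isRegular_succ hκ
    have hlt : ⨆ x, Order.succ (γ x) < (Order.succ κ).ord := by
      refine Ordinal.iSup_lt_of_lt_cof ?_ fun x => ?_
      · rw [hreg.cof_ord]
        exact hp.trans_lt (Order.lt_succ κ)
      · exact (Cardinal.isSuccLimit_ord hreg.aleph0_le).succ_lt (hγ x)
    obtain ⟨α, hα, hrank⟩ := exists_hasNWRankAux_le (p := p) (β := ⨆ x, Order.succ (γ x)) fun x =>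
      (hr x).imp_right fun hx => ⟨γ x, (Order.lt_succ _).trans_le (Ordinal.le_iSup _ x), hx⟩
    exact ⟨α, hα.trans_lt hlt, hrank⟩

/-- For every infinite cardinal `κ`, every rooted tree of size at most `κ` has a
Nash-Williams rank, and this rank is an ordinal strictly less than `κ⁺`. -/
theorem rooted_tree_has_nwRank (κ : Cardinal.{u}) (hκ : Cardinal.aleph0 ≤ κ)
    {V : Type u} (T : RootedGraph V) (hT : T.graph.IsTree) (hV : Cardinal.mk V ≤ κ) :
    ∃ α : Ordinal.{u}, α < (Order.succ κ).ord ∧ HasNWRankAux α ⟨V, T⟩ :=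
  IsRep.exists_hasNWRankAux hκ (d := T.graph.dist T.root)
    (ch := fun a b => T.graph.Adj a b ∧ T.graph.dist T.root b = T.graph.dist T.root a + 1)
    T.root ⟨V, T⟩ id ⟨Function.injective_id, hT.isChildRel, fun _ c _ => ⟨c, rfl⟩⟩ rfl hV
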